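/- Let 0 < α < 1 and β ∈ [0,1]. There exists a constant c > 0, depending only on α and β, with the following property. Let V be a nontrivial finite-dimensional complex inner product space, A : V → V a self-adjoint positive definite linear operator, v ∈ V, and let u : [0,∞) → V be continuous with u(0) = v, differentiable on (0,∞), such that for every t > 0 the function s ↦ (t-s)^{-α} ‖u'(s)‖ is integrable on (0,t) and ∂_t^α u(t) + A u(t) = 0, where ∂_t^α u(t) = (1/Γ(1-α)) ∫_0^t (t-s)^{-α} u'(s) ds. Let y(t) = u(t) - v. Then for every τ > 0 and every integer n ≥ 1, ‖A^{-β} ( ∂_t^α u(t_n) - ∂̄_τ^α y(t_n) )‖ ≤ c · τ · t_n^{-1 - (1-β)α} · ‖v‖, where t_k = kτ and ∂̄_τ^α y(t_n) = τ^{-α} Σ_{j=0}^n b_j^{(α)} y(t_{n-j}). -/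

import Mathlib

open scoped ComplexInnerProductSpace

/-- The backward Euler convolution quadrature weights `b_j^(α) = (-1)^j binom(α, j)`. -/
noncomputable def cqWeight (α : ℝ) (j : ℕ) : ℝ :=
  (-1 : ℝ) ^ j * (∏ i ∈ Finset.range j, (α - i)) / (Nat.factorial j)

/-- The Caputo derivative `∂_t^α u(t) = (1/Γ(1-α)) ∫_0^t (t-s)^{-α} u'(s) ds`,
expressed through the derivative function `u'`. -/
noncomputable def caputo (α : ℝ) {V : Type} [NormedAddCommGroup V] [NormedSpace ℝ V]
    (u' : ℝ → V) (t : ℝ) : V :=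
  (1 / Real.Gamma (1 - α)) • ∫ s in Set.Ioo 0 t, ((t - s) ^ (-α) : ℝ) • u' s

/-- Fractional power `A^β` via the functional (spectral) calculus. -/
noncomputable def opRPow {V : Type} [NormedAddCommGroup V] [InnerProductSpace ℂ V]
    [FiniteDimensional ℂ V] (A : V →L[ℂ] V) (β : ℝ) : V →L[ℂ] V :=
  cfc (fun x : ℝ => x ^ β) A

namespace MittagLeffler

open Real Set Filter Topology MeasureTheory

theorem Gamma_add_le {x a : ℝ} (hx : 0 < x) (ha0 : 0 < a) (ha1 : a < 1) :
    Gamma (x + a) ≤ x ^ a * Gamma x := by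
  have h := Gamma_mul_add_mul_le_rpow_Gamma_mul_rpow_Gamma hx (by linarith : 0 < x + 1)
    (by linarith : 0 < 1 - a) ha0 (by ring)
  rw [Gamma_add_one hx.ne', mul_rpow hx.le (Gamma_pos_of_pos hx).le,
    show (1 - a) * x + a * (x + 1) = x + a by ring] at h
  calc Gamma (x + a) ≤ x ^ a * (Gamma x ^ (1 - a) * Gamma x ^ a) := by linarith
    _ = x ^ a * Gamma x := by
      rw [← rpow_add (Gamma_pos_of_pos hx)]; simp

theorem Gamma_add_one_le {x a : ℝ} (hx : 0 < x) (ha0 : 0 < a) (ha1 : a < 1) :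
    Gamma (x + 1) ≤ (x + a) ^ (1 - a) * Gamma (x + a) := by
  have h := Gamma_add_le (x := x + a) (a := 1 - a) (by linarith) (by linarith) (by linarith)
  rwa [show x + a + (1 - a) = x + 1 by ring] at h

/-- Polynomially bounded sequences. -/
def PolyBdd (c : ℕ → ℝ) : Prop := ∃ (M : ℝ) (N : ℕ), 0 ≤ M ∧ ∀ k, |c k| ≤ M * ((k : ℝ) + 1) ^ N

theorem PolyBdd.mul {c d : ℕ → ℝ} (hc : PolyBdd c) (hd : PolyBdd d) :
    PolyBdd (fun k => c k * d k) := by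
  obtain ⟨M, N, hM, h⟩ := hc
  obtain ⟨M', N', hM', h'⟩ := hd
  refine ⟨M * M', N + N', by positivity, fun k => ?_⟩
  rw [abs_mul, pow_add]
  calc _ ≤ (M * ((k : ℝ) + 1) ^ N) * (M' * ((k : ℝ) + 1) ^ N') :=
        mul_le_mul (h k) (h' k) (abs_nonneg _) (by positivity)
    _ = _ := by ring

theorem PolyBdd.linear (a b : ℝ) : PolyBdd (fun k => a * ((k : ℝ) + 1) + b) := by
  refine ⟨|a| + |b|, 1, by positivity, fun k => ?_⟩
  have hk : (1 : ℝ) ≤ (k : ℝ) + 1 := by simp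
  calc |a * ((k : ℝ) + 1) + b| ≤ |a * ((k : ℝ) + 1)| + |b| := abs_add_le _ _
    _ = |a| * ((k : ℝ) + 1) + |b| := by rw [abs_mul, abs_of_pos (by linarith : (0 : ℝ) < k + 1)]
    _ ≤ |a| * ((k : ℝ) + 1) + |b| * ((k : ℝ) + 1) := by
      gcongr; exact le_mul_of_one_le_right (abs_nonneg _) hk
    _ = _ := by ring

theorem PolyBdd.shift {c : ℕ → ℝ} (hc : PolyBdd c) : PolyBdd (fun k => c (k + 1)) := by
  obtain ⟨M, N, hM, h⟩ := hc
  refine ⟨M * 2 ^ N, N, by positivity, fun k => (h (k + 1)).trans ?_⟩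
  rw [mul_assoc, ← mul_pow]
  push_cast
  gcongr
  have : (0 : ℝ) ≤ k := Nat.cast_nonneg k
  linarith

theorem PolyBdd.div_linear {c : ℕ → ℝ} (hc : PolyBdd c) {a : ℝ} (ha : 0 < a) :
    PolyBdd (fun k => c k / (a * ((k : ℝ) + 1))) := by
  obtain ⟨M, N, hM, h⟩ := hc
  refine ⟨M / a, N, by positivity, fun k => ?_⟩
  have hk : (1 : ℝ) ≤ (k : ℝ) + 1 := by simp
  rw [abs_div, abs_of_pos (by positivity : 0 < a * ((k : ℝ) + 1)), div_mul_eq_mul_div]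
  apply div_le_div₀ (by positivity) (h k) ha
  nlinarith

/-- The Mittag-Leffler coefficients `1 / Γ(α (k + 1))` beat every polynomial times geometric
sequence. -/
theorem summable_pow_mul_geometric_div_Gamma {α : ℝ} (hα0 : 0 < α) (hα1 : α < 1) (N : ℕ) {R : ℝ}
    (hR : 0 < R) :
    Summable (fun k : ℕ => ((k : ℝ) + 1) ^ N * R ^ k / Gamma (α * ((k : ℝ) + 1))) := by
  apply summable_of_ratio_norm_eventually_le (r := 1 / 2) (by norm_num)
  have hlim : Tendsto (fun k : ℕ => 2 ^ N * R * 2 ^ (1 - α) * (α * ((k : ℝ) + 1)) ^ (-α))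
      atTop (𝓝 (2 ^ N * R * 2 ^ (1 - α) * 0)) := by
    apply Tendsto.const_mul
    apply (tendsto_rpow_neg_atTop hα0).comp
    apply Tendsto.const_mul_atTop hα0
    exact tendsto_atTop_add_const_right _ _ tendsto_natCast_atTop_atTop
  rw [mul_zero] at hlim
  filter_upwards [hlim.eventually (ge_mem_nhds (by norm_num : (0 : ℝ) < 1 / 2))] with k hk
  set x := α * ((k : ℝ) + 1) with hx
  have hk1 : (1 : ℝ) ≤ (k : ℝ) + 1 := by simp
  have hxa : α ≤ x := by rw [hx]; nlinarith
  have hx0 : 0 < x := by linarith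
  have hG := Gamma_pos_of_pos hx0
  have hG' := Gamma_pos_of_pos (by linarith : 0 < x + α)
  have hxx : α * (((k + 1 : ℕ) : ℝ) + 1) = x + α := by rw [hx]; push_cast; ring
  rw [hxx, norm_of_nonneg (by positivity), norm_of_nonneg (by positivity)]
  have h1 := Gamma_add_one_le hx0 hα0 hα1
  rw [Gamma_add_one hx0.ne'] at h1
  have h2 : (x + α) ^ (1 - α) ≤ 2 ^ (1 - α) * x ^ (1 - α) := by
    rw [← mul_rpow (by norm_num) hx0.le]
    exact rpow_le_rpow (by linarith) (by linarith) (by linarith)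
  have h3 : 1 / Gamma (x + α) ≤ 2 ^ (1 - α) * x ^ (-α) / Gamma x := by
    rw [div_le_div_iff₀ hG' hG, one_mul]
    have h4 : x * Gamma x ≤ 2 ^ (1 - α) * x ^ (1 - α) * Gamma (x + α) :=
      h1.trans (mul_le_mul_of_nonneg_right h2 hG'.le)
    have h5 : x ^ (1 - α) = x * x ^ (-α) := by
      rw [sub_eq_add_neg, rpow_add hx0, rpow_one]
    rw [h5] at h4
    have : x * Gamma x ≤ x * (2 ^ (1 - α) * x ^ (-α) * Gamma (x + α)) := by linarith
    exact le_of_mul_le_mul_left this hx0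
  have h6 : (((k + 1 : ℕ) : ℝ) + 1) ^ N ≤ 2 ^ N * ((k : ℝ) + 1) ^ N := by
    rw [← mul_pow]; push_cast; gcongr; linarith
  calc (((k + 1 : ℕ) : ℝ) + 1) ^ N * R ^ (k + 1) / Gamma (x + α)
      = (((k + 1 : ℕ) : ℝ) + 1) ^ N * R ^ (k + 1) * (1 / Gamma (x + α)) := by ring
    _ ≤ (2 ^ N * ((k : ℝ) + 1) ^ N) * R ^ (k + 1) * (2 ^ (1 - α) * x ^ (-α) / Gamma x) := by
      gcongr
    _ = (2 ^ N * R * 2 ^ (1 - α) * x ^ (-α)) * (((k : ℝ) + 1) ^ N * R ^ k / Gamma x) := by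
      rw [pow_succ]; ring
    _ ≤ 1 / 2 * (((k : ℝ) + 1) ^ N * R ^ k / Gamma x) := by gcongr

theorem PolyBdd.summable {c : ℕ → ℝ} (hc : PolyBdd c) {α : ℝ} (hα0 : 0 < α) (hα1 : α < 1) {R : ℝ}
    (hR : 0 < R) : Summable (fun k : ℕ => |c k| * R ^ k / Gamma (α * ((k : ℝ) + 1))) := by
  obtain ⟨M, N, hM, h⟩ := hc
  have hG : ∀ k : ℕ, 0 < Gamma (α * ((k : ℝ) + 1)) := fun k => Gamma_pos_of_pos (by positivity)
  refine Summable.of_nonneg_of_le (fun k => ?_) (fun k => ?_)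
    ((summable_pow_mul_geometric_div_Gamma hα0 hα1 N hR).mul_left M)
  · have := hG k; positivity
  · have := hG k
    calc _ ≤ (M * ((k : ℝ) + 1) ^ N) * R ^ k / Gamma (α * ((k : ℝ) + 1)) := by
          gcongr; exact h k
      _ = _ := by ring

/-- The series `∑ c_k (-1)^k t^(α(k+1)-1) / Γ(α(k+1))`; for `c = 1` it is the Mittag-Leffler
function `t^(α-1) E_{α,α}(-t^α)`. -/
noncomputable def mlSeries (α : ℝ) (c : ℕ → ℝ) (t : ℝ) : ℝ :=
  ∑' k : ℕ, c k * ((-1) ^ k * t ^ (α * ((k : ℝ) + 1) - 1) / Gamma (α * ((k : ℝ) + 1)))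

section

variable {α : ℝ} {c : ℕ → ℝ}

theorem rpow_mul_succ_sub_one {t : ℝ} (ht : 0 < t) (k : ℕ) :
    t ^ (α * ((k : ℝ) + 1) - 1) = t ^ (α - 1) * (t ^ α) ^ k := by
  rw [← rpow_natCast (t ^ α), ← rpow_mul ht.le, ← rpow_add ht]
  congr 1; ring

theorem abs_mlSeries_term (hα0 : 0 < α) {t : ℝ} (ht : 0 < t) (k : ℕ) :
    |c k * ((-1) ^ k * t ^ (α * ((k : ℝ) + 1) - 1) / Gamma (α * ((k : ℝ) + 1)))|
      = t ^ (α - 1) * (|c k| * (t ^ α) ^ k / Gamma (α * ((k : ℝ) + 1))) := by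
  have hG : 0 < Gamma (α * ((k : ℝ) + 1)) := Gamma_pos_of_pos (by positivity)
  rw [rpow_mul_succ_sub_one ht, abs_mul, abs_div, abs_mul, abs_pow, abs_neg, abs_one, one_pow,
    abs_of_pos hG, one_mul,
    abs_of_pos (by positivity : 0 < t ^ (α - 1) * (t ^ α) ^ k)]
  ring

theorem summable_mlSeries (hα0 : 0 < α) (hα1 : α < 1) (hc : PolyBdd c) {t : ℝ} (ht : 0 < t) :
    Summable (fun k : ℕ =>
      c k * ((-1) ^ k * t ^ (α * ((k : ℝ) + 1) - 1) / Gamma (α * ((k : ℝ) + 1)))) := by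
  apply Summable.of_norm
  simp_rw [norm_eq_abs, abs_mlSeries_term hα0 ht]
  exact (hc.summable hα0 hα1 (rpow_pos_of_pos ht α)).mul_left _

theorem abs_mlSeries_le (hα0 : 0 < α) (hα1 : α < 1) (hc : PolyBdd c) (T : ℝ) :
    ∃ C, 0 ≤ C ∧ ∀ t, 0 < t → t ≤ T → |mlSeries α c t| ≤ C * t ^ (α - 1) := by
  rcases le_or_gt T 0 with hT | hT
  · exact ⟨0, le_rfl, fun t h1 h2 => absurd h1 (by linarith)⟩
  have hG : ∀ k : ℕ, 0 < Gamma (α * ((k : ℝ) + 1)) := fun k => Gamma_pos_of_pos (by positivity)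
  refine ⟨∑' k : ℕ, |c k| * (T ^ α) ^ k / Gamma (α * ((k : ℝ) + 1)),
    tsum_nonneg fun k => by have := hG k; positivity, fun t ht htT => ?_⟩
  have h1 := hc.summable hα0 hα1 (rpow_pos_of_pos hT α)
  rw [mul_comm, ← tsum_mul_left]
  have h2 := summable_mlSeries hα0 hα1 hc ht
  refine (norm_tsum_le_tsum_norm h2.norm).trans ?_
  refine h2.norm.tsum_le_tsum (fun k => ?_) (h1.mul_left _)
  rw [norm_eq_abs, abs_mlSeries_term hα0 ht]
  have := hG k
  have h3 : t ^ α ≤ T ^ α := rpow_le_rpow ht.le htT hα0.le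
  gcongr

theorem hasDerivAt_mlSeries (hα0 : 0 < α) (hα1 : α < 1) (hc : PolyBdd c) {t : ℝ} (ht : 0 < t) :
    HasDerivAt (mlSeries α c)
      (t⁻¹ * mlSeries α (fun k => (α * ((k : ℝ) + 1) + (-1)) * c k) t) t := by
  have hd : PolyBdd (fun k => (α * ((k : ℝ) + 1) + (-1)) * c k) := (PolyBdd.linear α (-1)).mul hc
  have hG : ∀ k : ℕ, 0 < Gamma (α * ((k : ℝ) + 1)) := fun k => Gamma_pos_of_pos (by positivity)
  have hsum := (hd.summable hα0 hα1 (rpow_pos_of_pos (by linarith : 0 < 2 * t) α)).mul_left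
    ((t / 2)⁻¹ * (t / 2) ^ (α - 1))
  have hmem : t ∈ Ioo (t / 2) (2 * t) := ⟨by linarith, by linarith⟩
  have key := hasDerivAt_tsum_of_isPreconnected (𝕜 := ℝ) (F := ℝ) (t := Ioo (t / 2) (2 * t))
    (g := fun (k : ℕ) y =>
      c k * ((-1) ^ k * y ^ (α * ((k : ℝ) + 1) - 1) / Gamma (α * ((k : ℝ) + 1))))
    (g' := fun (k : ℕ) y => y⁻¹ * (((α * ((k : ℝ) + 1) + (-1)) * c k) *
      ((-1) ^ k * y ^ (α * ((k : ℝ) + 1) - 1) / Gamma (α * ((k : ℝ) + 1)))))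
    hsum isOpen_Ioo isPreconnected_Ioo ?_ ?_ hmem (summable_mlSeries hα0 hα1 hc ht) hmem
  · rw [tsum_mul_left] at key
    exact key
  · intro k y hy
    have hy0 : 0 < y := by have := hy.1; linarith
    have h1 := Real.hasDerivAt_rpow_const (x := y) (p := α * ((k : ℝ) + 1) - 1) (Or.inl hy0.ne')
    have h2 := ((h1.const_mul ((-1) ^ k)).div_const (Gamma (α * ((k : ℝ) + 1)))).const_mul (c k)
    refine h2.congr_deriv ?_
    rw [rpow_sub_one hy0.ne']
    field_simp
    ring
  · intro k y hy
    have hy0 : 0 < y := by have := hy.1; linarith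
    rw [norm_mul, norm_inv, norm_of_nonneg hy0.le, norm_eq_abs,
      abs_mlSeries_term (c := fun k : ℕ => (α * ((k : ℝ) + 1) + (-1)) * c k) hα0 hy0, ← mul_assoc]
    have h1 : y⁻¹ ≤ (t / 2)⁻¹ := inv_anti₀ (by linarith) hy.1.le
    have h2 : y ^ (α - 1) ≤ (t / 2) ^ (α - 1) :=
      rpow_le_rpow_of_nonpos (by linarith) hy.1.le (by linarith)
    have h3 : y ^ α ≤ (2 * t) ^ α := rpow_le_rpow hy0.le hy.2.le hα0.le
    have := hG k
    gcongr

theorem mlSeries_eq_zero_add (hα0 : 0 < α) (hα1 : α < 1) (hc : PolyBdd c) {t : ℝ} (ht : 0 < t) :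
    mlSeries α c t = c 0 * (t ^ (α - 1) / Gamma α) + ∑' k : ℕ, c (k + 1) *
      ((-1) ^ (k + 1) * t ^ (α * (((k + 1 : ℕ) : ℝ) + 1) - 1)
        / Gamma (α * (((k + 1 : ℕ) : ℝ) + 1))) := by
  rw [mlSeries, (summable_mlSeries hα0 hα1 hc ht).tsum_eq_zero_add]
  simp

theorem mlSeries_pos_near_zero (hα0 : 0 < α) (hα1 : α < 1) (hc : PolyBdd c) (h0 : 0 < c 0) :
    ∃ δ, 0 < δ ∧ ∀ t, 0 < t → t ≤ δ → 0 < mlSeries α c t := by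
  have hG : ∀ k : ℕ, 0 < Gamma (α * ((k : ℝ) + 1)) := fun k => Gamma_pos_of_pos (by positivity)
  have hsum := (summable_nat_add_iff 1).2 (hc.summable hα0 hα1 one_pos)
  set B := ∑' k : ℕ, |c (k + 1)| * 1 ^ (k + 1) / Gamma (α * (((k + 1 : ℕ) : ℝ) + 1)) with hB
  have hlim : Tendsto (fun t : ℝ => t ^ α * B) (𝓝[>] 0) (𝓝 0) := by
    have h : ContinuousAt (fun t : ℝ => t ^ α * B) 0 :=
      (continuousAt_rpow_const _ _ (Or.inr hα0.le)).mul_const B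
    have := h.tendsto
    rw [zero_rpow hα0.ne', zero_mul] at this
    exact this.mono_left nhdsWithin_le_nhds
  have hpos : 0 < c 0 / Gamma α := div_pos h0 (Gamma_pos_of_pos hα0)
  obtain ⟨ε, hε, hε'⟩ := mem_nhdsGT_iff_exists_Ioc_subset.1 (hlim.eventually (gt_mem_nhds hpos))
  refine ⟨min ε 1, lt_min hε one_pos, fun t ht htδ => ?_⟩
  have h1 : t ^ α * B < c 0 / Gamma α := hε' ⟨ht, htδ.trans (min_le_left _ _)⟩
  have ht1 : t ≤ 1 := htδ.trans (min_le_right _ _)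
  rw [mlSeries_eq_zero_add hα0 hα1 hc ht]
  have hs := (summable_nat_add_iff 1).2 (summable_mlSeries hα0 hα1 hc ht)
  have h2 : |∑' k : ℕ, c (k + 1) *
      ((-1) ^ (k + 1) * t ^ (α * (((k + 1 : ℕ) : ℝ) + 1) - 1)
        / Gamma (α * (((k + 1 : ℕ) : ℝ) + 1)))| ≤ t ^ (α - 1) * t ^ α * B := by
    rw [hB, ← tsum_mul_left]
    refine (norm_tsum_le_tsum_norm hs.norm).trans ?_
    refine hs.norm.tsum_le_tsum (fun k => ?_) (hsum.mul_left _)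
    rw [norm_eq_abs, abs_mlSeries_term hα0 ht, mul_assoc, pow_succ' (t ^ α)]
    have := hG (k + 1)
    have h3 : (t ^ α) ^ k ≤ 1 ^ (k + 1) := by
      rw [one_pow]
      exact pow_le_one₀ (by positivity) (rpow_le_one ht.le ht1 hα0.le)
    calc _ = t ^ (α - 1) * (t ^ α * (|c (k + 1)| * (t ^ α) ^ k /
          Gamma (α * (((k + 1 : ℕ) : ℝ) + 1)))) := by ring
      _ ≤ _ := by gcongr
  have h4 := (abs_le.1 h2).1
  have h5 : 0 < t ^ (α - 1) := rpow_pos_of_pos ht _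
  have h6 : 0 < t ^ (α - 1) * (c 0 / Gamma α - t ^ α * B) := mul_pos h5 (by linarith)
  have h7 : c 0 * (t ^ (α - 1) / Gamma α) = t ^ (α - 1) * (c 0 / Gamma α) := by ring
  rw [h7]
  linarith

theorem integral_sub_rpow_mul_rpow (hα1 : α < 1) {p t : ℝ} (hp : 0 < p) (ht : 0 < t) :
    ∫ s in (0 : ℝ)..t, (t - s) ^ (-α) * s ^ (p - 1)
      = Gamma p * Gamma (1 - α) / Gamma (p + (1 - α)) * t ^ (p - α) := by
  have h := Complex.betaIntegral_scaled (p : ℂ) ((1 - α : ℝ) : ℂ) ht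
  rw [Complex.betaIntegral_eq_Gamma_mul_div _ _ (by simpa) (by simpa)] at h
  have h1 : ∫ x in (0 : ℝ)..t, (x : ℂ) ^ ((p : ℂ) - 1) * ((t : ℂ) - x) ^ (((1 - α : ℝ) : ℂ) - 1)
      = ((∫ s in (0 : ℝ)..t, (t - s) ^ (-α) * s ^ (p - 1) : ℝ) : ℂ) := by
    rw [← intervalIntegral.integral_ofReal]
    apply intervalIntegral.integral_congr
    intro x hx
    rw [uIcc_of_le ht.le] at hx
    simp only
    rw [← Complex.ofReal_sub, ← Complex.ofReal_one, ← Complex.ofReal_sub, ← Complex.ofReal_sub,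
      ← Complex.ofReal_cpow hx.1, ← Complex.ofReal_cpow (by linarith [hx.2]), ← Complex.ofReal_mul,
      show 1 - α - 1 = -α by ring, mul_comm]
  rw [h1, show (p : ℂ) + ((1 - α : ℝ) : ℂ) - 1 = ((p - α : ℝ) : ℂ) by push_cast; ring,
    ← Complex.ofReal_cpow ht.le, ← Complex.ofReal_add, Complex.Gamma_ofReal, Complex.Gamma_ofReal,
    Complex.Gamma_ofReal] at h
  have h2 : (∫ s in (0 : ℝ)..t, (t - s) ^ (-α) * s ^ (p - 1))
      = t ^ (p - α) * (Gamma p * Gamma (1 - α) / Gamma (p + (1 - α))) := by exact_mod_cast h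
  rw [h2, mul_comm]

theorem intervalIntegrable_sub_rpow_mul_rpow (hα1 : α < 1) {p t : ℝ} (hp : 0 < p) (ht : 0 < t) :
    IntervalIntegrable (fun s => (t - s) ^ (-α) * s ^ (p - 1)) volume 0 t := by
  by_contra hcon
  have h := intervalIntegral.integral_undef hcon
  rw [integral_sub_rpow_mul_rpow hα1 hp ht] at h
  have h1 := Gamma_pos_of_pos hp
  have h2 := Gamma_pos_of_pos (by linarith : 0 < 1 - α)
  have h3 := Gamma_pos_of_pos (by linarith : 0 < p + (1 - α))
  have h4 : 0 < Gamma p * Gamma (1 - α) / Gamma (p + (1 - α)) * t ^ (p - α) := by positivity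
  linarith

theorem continuousOn_mlSeries (hα0 : 0 < α) (hα1 : α < 1) (hc : PolyBdd c) :
    ContinuousOn (mlSeries α c) (Ioi 0) := fun _ ht =>
  (hasDerivAt_mlSeries hα0 hα1 hc ht).continuousAt.continuousWithinAt

theorem intervalIntegrable_sub_rpow_mul_mlSeries (hα0 : 0 < α) (hα1 : α < 1) (hc : PolyBdd c)
    {t : ℝ} (ht : 0 < t) :
    IntervalIntegrable (fun s => (t - s) ^ (-α) * mlSeries α c s) volume 0 t := by
  obtain ⟨C, hC, hb⟩ := abs_mlSeries_le hα0 hα1 hc t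
  have h1 := (intervalIntegrable_sub_rpow_mul_rpow hα1 hα0 ht).const_mul C
  rw [intervalIntegrable_iff_integrableOn_Ioo_of_le ht.le] at h1 ⊢
  refine Integrable.mono' h1 ?_ ?_
  · apply ContinuousOn.aestronglyMeasurable _ measurableSet_Ioo
    apply ContinuousOn.mul
    · intro s hs
      apply ContinuousAt.continuousWithinAt
      apply ContinuousAt.rpow_const (by fun_prop) (Or.inl (by linarith [hs.2]))
    · exact (continuousOn_mlSeries hα0 hα1 hc).mono fun s hs => hs.1
  · refine (ae_restrict_iff' measurableSet_Ioo).2 (ae_of_all _ fun s hs => ?_)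
    have h2 : 0 < (t - s) ^ (-α) := rpow_pos_of_pos (by linarith [hs.2]) _
    rw [norm_mul, norm_of_nonneg h2.le, norm_eq_abs]
    calc _ ≤ (t - s) ^ (-α) * (C * s ^ (α - 1)) := by gcongr; exact hb s hs.1 hs.2.le
      _ = _ := by ring

/-- The function whose derivative is the Riemann-Liouville derivative of `mlSeries α c`. -/
noncomputable def mlPrimitive (α : ℝ) (c : ℕ → ℝ) (t : ℝ) : ℝ :=
  c 0 - t * mlSeries α (fun k => c (k + 1) / (α * ((k : ℝ) + 1))) t

theorem hasDerivAt_mlPrimitive (hα0 : 0 < α) (hα1 : α < 1) (hc : PolyBdd c) {t : ℝ} (ht : 0 < t) :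
    HasDerivAt (mlPrimitive α c) (-mlSeries α (fun k => c (k + 1)) t) t := by
  have hd : PolyBdd (fun k => c (k + 1) / (α * ((k : ℝ) + 1))) := hc.shift.div_linear hα0
  have h := ((hasDerivAt_id t).mul (hasDerivAt_mlSeries hα0 hα1 hd ht)).const_sub (c 0)
  refine h.congr_deriv ?_
  simp only [id, one_mul]
  rw [← mul_assoc, mul_inv_cancel₀ ht.ne', one_mul, mlSeries, mlSeries, mlSeries,
    ← (summable_mlSeries hα0 hα1 hd ht).tsum_add
      (summable_mlSeries hα0 hα1 ((PolyBdd.linear α (-1)).mul hd) ht)]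
  congr 1
  refine tsum_congr fun k => ?_
  have hk : α * ((k : ℝ) + 1) ≠ 0 := by positivity
  field_simp
  ring

theorem integral_sub_rpow_mul_mlSeries (hα0 : 0 < α) (hα1 : α < 1) (hc : PolyBdd c)
    {t : ℝ} (ht : 0 < t) :
    ∫ s in (0 : ℝ)..t, (t - s) ^ (-α) * mlSeries α c s = Gamma (1 - α) * mlPrimitive α c t := by
  have hG : ∀ k : ℕ, 0 < Gamma (α * ((k : ℝ) + 1)) := fun k => Gamma_pos_of_pos (by positivity)
  have hG' : ∀ k : ℕ, 0 < Gamma (α * k + 1) := fun k => Gamma_pos_of_pos (by positivity)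
  have hG1 : 0 < Gamma (1 - α) := Gamma_pos_of_pos (by linarith)
  have hd : PolyBdd (fun k => c (k + 1) / (α * ((k : ℝ) + 1))) := hc.shift.div_linear hα0
  let F : ℕ → ℝ → ℝ := fun k s => (c k * ((-1) ^ k / Gamma (α * ((k : ℝ) + 1)))) *
    ((t - s) ^ (-α) * s ^ (α * ((k : ℝ) + 1) - 1))
  have hint : ∀ k, IntervalIntegrable (F k) volume 0 t := fun k =>
    (intervalIntegrable_sub_rpow_mul_rpow hα1
      (by positivity : 0 < α * ((k : ℝ) + 1)) ht).const_mul _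
  have hval : ∀ k : ℕ, ∫ s in (0 : ℝ)..t, (t - s) ^ (-α) * s ^ (α * ((k : ℝ) + 1) - 1)
      = Gamma (α * ((k : ℝ) + 1)) * Gamma (1 - α) / Gamma (α * k + 1) * (t ^ α) ^ k := fun k => by
    rw [integral_sub_rpow_mul_rpow hα1 (by positivity) ht, ← rpow_natCast (t ^ α),
      ← rpow_mul ht.le]
    congr 3 <;> ring
  have hsum1 : Summable (fun k : ℕ => c k * (-1) ^ k * (t ^ α) ^ k / Gamma (α * k + 1)) := by
    rw [← summable_nat_add_iff 1]
    apply Summable.of_norm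
    refine ((hd.summable hα0 hα1 (rpow_pos_of_pos ht α)).mul_left (t ^ α)).congr fun k => ?_
    have hk : 0 < α * ((k : ℝ) + 1) := by positivity
    rw [norm_div, norm_mul, norm_mul, norm_pow, norm_neg, norm_one, one_pow, mul_one, norm_pow,
      norm_of_nonneg (hG' _).le, norm_of_nonneg (rpow_nonneg ht.le α), abs_div, abs_of_pos hk]
    push_cast
    rw [Gamma_add_one hk.ne', norm_eq_abs]
    have := (hG k).ne'
    field_simp
    ring
  have hnorm : ∀ k, ∫ s in Ioc 0 t, ‖F k s‖
      = Gamma (1 - α) * ‖c k * (-1) ^ k * (t ^ α) ^ k / Gamma (α * k + 1)‖ := fun k => by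
    have h1 : ∫ s in Ioc 0 t, ‖F k s‖ = ∫ s in Ioc 0 t,
        ‖c k * ((-1) ^ k / Gamma (α * ((k : ℝ) + 1)))‖ *
          ((t - s) ^ (-α) * s ^ (α * ((k : ℝ) + 1) - 1)) := by
      refine setIntegral_congr_fun measurableSet_Ioc fun s hs => ?_
      simp only [F]
      have hts : 0 ≤ t - s := by linarith [hs.2]
      rw [norm_mul, norm_of_nonneg (mul_nonneg (rpow_nonneg hts _) (rpow_nonneg hs.1.le _))]
    rw [h1, integral_const_mul, ← intervalIntegral.integral_of_le ht.le, hval]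
    simp only [norm_mul, norm_div, norm_pow, norm_neg, norm_one, one_pow,
      norm_of_nonneg (hG' _).le, norm_of_nonneg (hG _).le, norm_of_nonneg (rpow_nonneg ht.le α)]
    have := (hG k).ne'
    field_simp
  have hmain := hasSum_integral_of_summable_integral_norm (μ := volume.restrict (Ioc 0 t))
    (F := F) (fun k => (intervalIntegrable_iff_integrableOn_Ioc_of_le ht.le).1 (hint k))
    (by simp_rw [hnorm]; exact hsum1.norm.mul_left _)
  have hval' : ∀ k, ∫ s in Ioc 0 t, F k s
      = Gamma (1 - α) * (c k * (-1) ^ k * (t ^ α) ^ k / Gamma (α * k + 1)) := fun k => by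
    simp only [F]
    rw [integral_const_mul, ← intervalIntegral.integral_of_le ht.le, hval]
    have := (hG k).ne'
    field_simp
  have hF : ∫ s in (0 : ℝ)..t, (t - s) ^ (-α) * mlSeries α c s = ∫ s in Ioc 0 t, ∑' k, F k s := by
    rw [intervalIntegral.integral_of_le ht.le]
    congr 1
    ext s
    simp only [F]
    rw [mlSeries, ← tsum_mul_left]
    refine tsum_congr fun k => by ring
  rw [hF, ← hmain.tsum_eq, tsum_congr hval', tsum_mul_left, hsum1.tsum_eq_zero_add, mlPrimitive,
    mlSeries, ← tsum_mul_left, sub_eq_add_neg (c 0), ← tsum_neg]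
  congr 2
  · simp
  · refine tsum_congr fun k => ?_
    have hk : 0 < α * ((k : ℝ) + 1) := by positivity
    rw [rpow_mul_succ_sub_one ht, rpow_sub_one ht.ne']
    push_cast
    rw [Gamma_add_one hk.ne']
    have := (hG k).ne'
    field_simp
    ring

end

section

variable {α : ℝ}

theorem integral_sub_rpow (hα1 : α < 1) {t : ℝ} (ht : 0 < t) :
    ∫ s in (0 : ℝ)..t, (t - s) ^ (-α) = t ^ (1 - α) / (1 - α) := by
  have h := integral_sub_rpow_mul_rpow hα1 one_pos ht
  have h1 : 0 < 1 - α := by linarith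
  simp only [sub_self, rpow_zero, mul_one] at h
  rw [h, add_comm, Gamma_add_one h1.ne', Gamma_one]
  have := (Gamma_pos_of_pos h1).ne'
  field_simp

theorem intervalIntegrable_sub_rpow (hα1 : α < 1) {t : ℝ} (ht : 0 < t) :
    IntervalIntegrable (fun s => (t - s) ^ (-α)) volume 0 t := by
  simpa using intervalIntegrable_sub_rpow_mul_rpow hα1 one_pos ht

theorem exists_abs_sub_le_of_differentiableAt {f : ℝ → ℝ} {t : ℝ} (ht : 0 < t)
    (hf : DifferentiableAt ℝ f t) :
    ∃ C, 0 ≤ C ∧ ∃ δ, 0 ≤ δ ∧ δ < t ∧ ∀ s ∈ Ioo δ t, |f s - f t| ≤ C * (t - s) := by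
  obtain ⟨C, hC, hb⟩ := hf.hasDerivAt.isBigO_sub.exists_nonneg
  have h1 : ∀ᶠ s in 𝓝[<] t, ‖f s - f t‖ ≤ C * ‖s - t‖ := hb.bound.filter_mono nhdsWithin_le_nhds
  obtain ⟨l, hl, hl'⟩ := (mem_nhdsLT_iff_exists_Ioo_subset' ht).1 h1
  refine ⟨C, hC, max l 0, le_max_right _ _, max_lt hl ht, fun s hs => ?_⟩
  have h2 := hl' ⟨(le_max_left _ _).trans_lt hs.1, hs.2⟩
  simp only [mem_ofPred_eq, norm_eq_abs] at h2
  rwa [abs_sub_comm s t, abs_of_pos (by linarith [hs.2] : 0 < t - s)] at h2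

theorem tendsto_const_mul_sub_rpow (hα1 : α < 1) (C t : ℝ) :
    Tendsto (fun s => C * (t - s) ^ (1 - α)) (𝓝[<] t) (𝓝 0) := by
  have h : ContinuousAt (fun s => C * (t - s) ^ (1 - α)) t :=
    continuousAt_const.mul
      (ContinuousAt.rpow_const (by fun_prop) (Or.inr (by linarith)))
  have h1 := h.tendsto
  simp only [sub_self] at h1
  rw [zero_rpow (by linarith), mul_zero] at h1
  exact h1.mono_left nhdsWithin_le_nhds

/-- At a minimum the Riemann-Liouville derivative is bounded by that of the constant function. -/
theorem deriv_fracIntegral_le_of_min (hα0 : 0 < α) (hα1 : α < 1) {w : ℝ → ℝ} {d t₀ : ℝ}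
    (ht₀ : 0 < t₀) (hw : DifferentiableAt ℝ w t₀)
    (hint : ∀ t, 0 < t → t ≤ t₀ → IntervalIntegrable (fun s => (t - s) ^ (-α) * w s) volume 0 t)
    (hmin : ∀ s ∈ Ioo 0 t₀, w t₀ ≤ w s)
    (hJ : HasDerivAt (fun t => ∫ s in (0 : ℝ)..t, (t - s) ^ (-α) * w s) d t₀) :
    d ≤ w t₀ * t₀ ^ (-α) := by
  obtain ⟨C, hC, δ, hδ0, hδ, hb⟩ := exists_abs_sub_le_of_differentiableAt ht₀ hw
  let G : ℝ → ℝ := fun t =>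
    (∫ s in (0 : ℝ)..t, (t - s) ^ (-α) * w s) - w t₀ * (t ^ (1 - α) / (1 - α))
  have hG : HasDerivAt G (d - w t₀ * t₀ ^ (-α)) t₀ := by
    have h1 := Real.hasDerivAt_rpow_const (x := t₀) (p := 1 - α) (Or.inl ht₀.ne')
    refine (hJ.sub ((h1.div_const (1 - α)).const_mul (w t₀))).congr_deriv ?_
    have : 1 - α ≠ 0 := by linarith
    rw [show 1 - α - 1 = -α by ring]
    field_simp
  have hintv : ∀ t, 0 < t → t ≤ t₀ →
      IntervalIntegrable (fun s => (t - s) ^ (-α) * (w s - w t₀)) volume 0 t := fun t h0 h1 => by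
    refine ((hint t h0 h1).sub ((intervalIntegrable_sub_rpow hα1 h0).mul_const (w t₀))).congr ?_
    intro s _
    simp only
    ring
  have hGv : ∀ t, 0 < t → t ≤ t₀ → G t = ∫ s in (0 : ℝ)..t, (t - s) ^ (-α) * (w s - w t₀) := by
    intro t h0 h1
    simp only [G]
    rw [← integral_sub_rpow hα1 h0, mul_comm (w t₀), ← intervalIntegral.integral_mul_const,
      ← intervalIntegral.integral_sub (hint t h0 h1)
        ((intervalIntegrable_sub_rpow hα1 h0).mul_const (w t₀))]
    congr 1; ext s; ring
  have hinc : ∀ t ∈ Ioo δ t₀, G t₀ - G t ≤ C * (t₀ - t) ^ (1 - α) * (t₀ - t) := by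
    intro t ht
    have ht0 : 0 < t := hδ0.trans_lt ht.1
    have hi := hintv t₀ ht₀ le_rfl
    have hi1 : IntervalIntegrable (fun s => (t₀ - s) ^ (-α) * (w s - w t₀)) volume 0 t :=
      hi.mono_set (by rw [uIcc_of_le ht0.le, uIcc_of_le ht₀.le]; exact Icc_subset_Icc_right ht.2.le)
    have hi2 : IntervalIntegrable (fun s => (t₀ - s) ^ (-α) * (w s - w t₀)) volume t t₀ :=
      hi.mono_set (by
        rw [uIcc_of_le ht.2.le, uIcc_of_le ht₀.le]; exact Icc_subset_Icc_left ht0.le)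
    rw [hGv t₀ ht₀ le_rfl, hGv t ht0 ht.2.le,
      ← intervalIntegral.integral_add_adjacent_intervals hi1 hi2]
    have h1 : ∫ s in (0 : ℝ)..t, (t₀ - s) ^ (-α) * (w s - w t₀)
        ≤ ∫ s in (0 : ℝ)..t, (t - s) ^ (-α) * (w s - w t₀) := by
      apply intervalIntegral.integral_mono_on_of_le_Ioo ht0.le hi1 (hintv t ht0 ht.2.le)
      intro s hs
      apply mul_le_mul_of_nonneg_right
      · exact rpow_le_rpow_of_nonpos (by linarith [hs.2]) (by linarith [ht.2]) (by linarith)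
      · have := hmin s ⟨hs.1, hs.2.trans ht.2⟩
        linarith
    have h2 : ∫ s in t..t₀, (t₀ - s) ^ (-α) * (w s - w t₀)
        ≤ ∫ s in t..t₀, C * (t₀ - t) ^ (1 - α) := by
      apply intervalIntegral.integral_mono_on_of_le_Ioo ht.2.le hi2 (by simp)
      intro s hs
      have hs0 : 0 < t₀ - s := by linarith [hs.2]
      have h3 := (le_abs_self _).trans (hb s ⟨ht.1.trans hs.1, hs.2⟩)
      calc (t₀ - s) ^ (-α) * (w s - w t₀) ≤ (t₀ - s) ^ (-α) * (C * (t₀ - s)) := by gcongr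
        _ = C * (t₀ - s) ^ (1 - α) := by
          rw [sub_eq_add_neg 1 α, rpow_add hs0, rpow_one]; ring
        _ ≤ C * (t₀ - t) ^ (1 - α) := by
          have hst : t₀ - s ≤ t₀ - t := by linarith [hs.1]
          have h1α : 0 ≤ 1 - α := by linarith
          gcongr
    rw [intervalIntegral.integral_const, smul_eq_mul] at h2
    linarith
  have hslope := (hasDerivAt_iff_tendsto_slope.1 hG).mono_left
    (nhdsWithin_mono t₀ (fun x hx => ne_of_lt hx : Iio t₀ ⊆ {t₀}ᶜ))
  have hle := le_of_tendsto_of_tendsto hslope (tendsto_const_mul_sub_rpow hα1 C t₀) (by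
    filter_upwards [Ioo_mem_nhdsLT hδ] with t ht
    have h0 : 0 < t₀ - t := by linarith [ht.2]
    rw [slope_def_field, ← neg_div_neg_eq, neg_sub, neg_sub, div_le_iff₀ h0]
    exact hinc t ht)
  linarith

/-- At a maximum over the past the Caputo derivative is nonnegative. -/
theorem integral_sub_rpow_mul_deriv_nonneg_of_max (hα0 : 0 < α) (hα1 : α < 1) {f f' : ℝ → ℝ}
    {t₀ : ℝ} (ht₀ : 0 < t₀) (hc : ContinuousOn f (Icc 0 t₀))
    (hd : ∀ t, 0 < t → HasDerivAt f (f' t) t)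
    (hint : IntervalIntegrable (fun s => (t₀ - s) ^ (-α) * f' s) volume 0 t₀)
    (hmax : ∀ s ∈ Icc 0 t₀, f s ≤ f t₀) :
    0 ≤ ∫ s in (0 : ℝ)..t₀, (t₀ - s) ^ (-α) * f' s := by
  obtain ⟨C, hC, δ, hδ0, hδ, hb⟩ :=
    exists_abs_sub_le_of_differentiableAt ht₀ (hd t₀ ht₀).differentiableAt
  have hlim : Tendsto (fun b => ∫ s in (0 : ℝ)..b, (t₀ - s) ^ (-α) * f' s) (𝓝[<] t₀)
      (𝓝 (∫ s in (0 : ℝ)..t₀, (t₀ - s) ^ (-α) * f' s)) := by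
    have h1 := intervalIntegral.continuousOn_primitive_interval'
      (b₁ := 0) (b₂ := t₀) hint left_mem_uIcc
    have h2 := (h1 t₀ right_mem_uIcc).tendsto
    refine h2.mono_left ?_
    rw [uIcc_of_le ht₀.le]
    exact (nhdsWithin_mono t₀ Ioo_subset_Icc_self).trans_eq' (nhdsWithin_Ioo_eq_nhdsLT ht₀)
  refine le_of_tendsto_of_tendsto (tendsto_const_mul_sub_rpow hα1 (-C) t₀) hlim ?_
  filter_upwards [Ioo_mem_nhdsLT hδ] with b hbm
  have hb0 : 0 < b := hδ0.trans_lt hbm.1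
  have hbt : 0 < t₀ - b := by linarith [hbm.2]
  have hsub : Icc 0 b ⊆ Icc 0 t₀ := Icc_subset_Icc_right hbm.2.le
  have hk : ∀ s ∈ Icc 0 b, 0 < t₀ - s := fun s hs => by linarith [hs.2]
  have key := intervalIntegral.sub_le_integral_of_hasDeriv_right_of_le hb0.le
    (g := fun s => (t₀ - s) ^ (-α) * (f s - f t₀))
    (g' := fun s => (-1 * (-α) * (t₀ - s) ^ (-α - 1)) * (f s - f t₀) + (t₀ - s) ^ (-α) * f' s)
    (φ := fun s => (t₀ - s) ^ (-α) * f' s) ?_ ?_ ?_ ?_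
  · have h0 : (t₀ - 0) ^ (-α) * (f 0 - f t₀) ≤ 0 :=
      mul_nonpos_of_nonneg_of_nonpos (rpow_nonneg (by linarith) _)
        (by linarith [hmax 0 ⟨le_rfl, ht₀.le⟩])
    have h1 := (abs_le.1 (hb b hbm)).1
    have h2 : -C * (t₀ - b) ^ (1 - α) ≤ (t₀ - b) ^ (-α) * (f b - f t₀) := by
      calc -C * (t₀ - b) ^ (1 - α) = (t₀ - b) ^ (-α) * -(C * (t₀ - b)) := by
            rw [sub_eq_add_neg 1 α, rpow_add hbt, rpow_one]; ring
        _ ≤ _ := by gcongr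
    linarith
  · apply ContinuousOn.mul
    · exact ContinuousOn.rpow_const (by fun_prop) (fun s hs => Or.inl (hk s hs).ne')
    · exact (hc.mono hsub).sub continuousOn_const
  · intro s hs
    have h1 := ((hasDerivAt_id s).const_sub t₀).rpow_const (p := -α)
      (Or.inl (hk s ⟨hs.1.le, hs.2.le⟩).ne')
    exact (h1.mul ((hd s hs.1).sub_const (f t₀))).hasDerivWithinAt
  · rw [intervalIntegrable_iff_integrableOn_Icc_of_le ht₀.le] at hint
    exact hint.mono_set hsub
  · intro s hs
    have h1 := hmax s ⟨hs.1.le, hs.2.le.trans hbm.2.le⟩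
    have h2 := rpow_pos_of_pos (hk s ⟨hs.1.le, hs.2.le⟩) (-α - 1)
    have h3 : (-1 * (-α) * (t₀ - s) ^ (-α - 1)) * (f s - f t₀) ≤ 0 :=
      mul_nonpos_of_nonneg_of_nonpos (by nlinarith) (by linarith)
    linarith

theorem nonpos_of_fracODE (hα0 : 0 < α) (hα1 : α < 1) {f f' : ℝ → ℝ} {l : ℝ} (hl : 0 < l)
    (hc : ContinuousOn f (Ici 0)) (h0 : f 0 = 0) (hd : ∀ t, 0 < t → HasDerivAt f (f' t) t)
    (hint : ∀ t, 0 < t → IntervalIntegrable (fun s => (t - s) ^ (-α) * f' s) volume 0 t)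
    (heq : ∀ t, 0 < t → ∫ s in (0 : ℝ)..t, (t - s) ^ (-α) * f' s = -l * f t) {t : ℝ}
    (ht : 0 ≤ t) : f t ≤ 0 := by
  by_contra! hpos
  have hct : ContinuousOn f (Icc 0 t) := hc.mono Icc_subset_Ici_self
  obtain ⟨t₀, ht₀, hmax⟩ := isCompact_Icc.exists_isMaxOn ⟨t, right_mem_Icc.2 ht⟩ hct
  have hft₀ : 0 < f t₀ := hpos.trans_le (hmax (right_mem_Icc.2 ht))
  have h₀ : 0 < t₀ := by
    rcases ht₀.1.eq_or_lt with h | h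
    · rw [← h, h0] at hft₀
      exact absurd hft₀ (lt_irrefl _)
    · exact h
  have hsub : Icc 0 t₀ ⊆ Icc 0 t := Icc_subset_Icc_right ht₀.2
  have key := integral_sub_rpow_mul_deriv_nonneg_of_max hα0 hα1 h₀ (hct.mono hsub) hd
    (hint t₀ h₀) (fun s hs => hmax (hsub hs))
  rw [heq t₀ h₀] at key
  nlinarith

/-- Uniqueness for the scalar fractional relaxation equation. -/
theorem eq_zero_of_fracODE (hα0 : 0 < α) (hα1 : α < 1) {f f' : ℝ → ℝ} {l : ℝ} (hl : 0 < l)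
    (hc : ContinuousOn f (Ici 0)) (h0 : f 0 = 0) (hd : ∀ t, 0 < t → HasDerivAt f (f' t) t)
    (hint : ∀ t, 0 < t → IntervalIntegrable (fun s => (t - s) ^ (-α) * f' s) volume 0 t)
    (heq : ∀ t, 0 < t → ∫ s in (0 : ℝ)..t, (t - s) ^ (-α) * f' s = -l * f t) {t : ℝ}
    (ht : 0 ≤ t) : f t = 0 := by
  refine le_antisymm (nonpos_of_fracODE hα0 hα1 hl hc h0 hd hint heq ht) ?_
  have h := nonpos_of_fracODE hα0 hα1 hl hc.neg (by simp [h0]) (fun t ht => (hd t ht).neg)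
    (f' := fun t => -f' t) (fun t ht => by
      simp only [mul_neg]
      exact (hint t ht).neg)
    (fun t ht => by
      simp only [mul_neg, intervalIntegral.integral_neg, heq t ht, Pi.neg_apply]) ht
  simp only [Pi.neg_apply] at h
  linarith

theorem mlSeries_neg (α : ℝ) (c : ℕ → ℝ) (t : ℝ) :
    mlSeries α (fun k => -c k) t = -mlSeries α c t := by
  simp only [mlSeries, neg_mul, tsum_neg]

theorem mlSeries_const_mul (α a : ℝ) (c : ℕ → ℝ) (t : ℝ) :
    mlSeries α (fun k => a * c k) t = a * mlSeries α c t := by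
  simp only [mlSeries, mul_assoc, tsum_mul_left]

theorem mlSeries_sub (hα0 : 0 < α) (hα1 : α < 1) {c d : ℕ → ℝ} (hc : PolyBdd c) (hd : PolyBdd d)
    {t : ℝ} (ht : 0 < t) :
    mlSeries α (fun k => c k - d k) t = mlSeries α c t - mlSeries α d t := by
  simp only [mlSeries, sub_mul]
  exact (summable_mlSeries hα0 hα1 hc ht).tsum_sub (summable_mlSeries hα0 hα1 hd ht)

theorem mlSeries_nonneg_of_diff (hα0 : 0 < α) (hα1 : α < 1) {c : ℕ → ℝ} (hc : PolyBdd c)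
    (h0 : 0 < c 0) (hdiff : ∀ t, 0 < t → 0 ≤ mlSeries α (fun k => c k - c (k + 1)) t) {t : ℝ}
    (ht : 0 < t) : 0 ≤ mlSeries α c t := by
  by_contra! hneg
  obtain ⟨δ, hδ, hpos⟩ := mlSeries_pos_near_zero hα0 hα1 hc h0
  have hδt : δ < t := by
    by_contra! h
    exact absurd (hpos t ht h) (by linarith)
  obtain ⟨t₀, ht₀, hmin⟩ := isCompact_Icc.exists_isMinOn ⟨t, right_mem_Icc.2 hδt.le⟩
    ((continuousOn_mlSeries hα0 hα1 hc).mono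
      (fun s hs => hδ.trans_le hs.1 : Icc δ t ⊆ Ioi 0))
  have hw : mlSeries α c t₀ < 0 := (hmin (right_mem_Icc.2 hδt.le)).trans_lt hneg
  have h₀ : 0 < t₀ := hδ.trans_le ht₀.1
  have hJ : HasDerivAt (fun t => ∫ s in (0 : ℝ)..t, (t - s) ^ (-α) * mlSeries α c s)
      (Gamma (1 - α) * -mlSeries α (fun k => c (k + 1)) t₀) t₀ := by
    refine ((hasDerivAt_mlPrimitive hα0 hα1 hc h₀).const_mul (Gamma (1 - α))).congr_of_eventuallyEq
      ?_
    filter_upwards [lt_mem_nhds h₀] with s hs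
    exact integral_sub_rpow_mul_mlSeries hα0 hα1 hc hs
  have key := deriv_fracIntegral_le_of_min hα0 hα1 h₀
    (hasDerivAt_mlSeries hα0 hα1 hc h₀).differentiableAt
    (fun s hs _ => intervalIntegrable_sub_rpow_mul_mlSeries hα0 hα1 hc hs)
    (fun s hs => by
      rcases le_or_gt s δ with h | h
      · exact hw.le.trans (hpos s hs.1 h).le
      · exact hmin ⟨h.le, hs.2.le.trans ht₀.2⟩) hJ
  have h1 := hdiff t₀ h₀
  rw [mlSeries_sub hα0 hα1 hc hc.shift h₀] at h1
  have h2 : mlSeries α c t₀ * t₀ ^ (-α) < 0 :=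
    mul_neg_of_neg_of_pos hw (rpow_pos_of_pos h₀ _)
  have h3 : 0 < Gamma (1 - α) := Gamma_pos_of_pos (by linarith)
  have h4 : 0 < Gamma (1 - α) * -mlSeries α (fun k => c (k + 1)) t₀ :=
    mul_pos h3 (by linarith)
  linarith

/-- The resolvent kernel `t^(α-1) E_{α,α}(-t^α)`. -/
noncomputable def mlKernel (α t : ℝ) : ℝ := mlSeries α (fun _ => 1) t

/-- Minus the derivative of `mlKernel`. -/
noncomputable def mlKernelSlope (α t : ℝ) : ℝ :=
  t⁻¹ * mlSeries α (fun k => -α * ((k : ℝ) + 1) + 1) t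

/-- The relaxation function `E_α(-t^α)`. -/
noncomputable def mlRelax (α t : ℝ) : ℝ := mlPrimitive α (fun _ => 1) t

theorem polyBdd_one : PolyBdd (fun _ => 1) := by
  simpa using PolyBdd.linear 0 1

theorem mlKernel_nonneg (hα0 : 0 < α) (hα1 : α < 1) {t : ℝ} (ht : 0 < t) : 0 ≤ mlKernel α t :=
  mlSeries_nonneg_of_diff hα0 hα1 polyBdd_one one_pos (fun t _ => by simp [mlSeries]) ht

theorem mlSeries_linear_nonneg (hα0 : 0 < α) (hα1 : α < 1) {t : ℝ} (ht : 0 < t) :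
    0 ≤ mlSeries α (fun k => -α * ((k : ℝ) + 1) + 1) t := by
  refine mlSeries_nonneg_of_diff hα0 hα1 (PolyBdd.linear _ _) (by simpa using hα1)
    (fun t ht => ?_) ht
  have h : (fun k : ℕ => -α * ((k : ℝ) + 1) + 1 - (-α * (((k + 1 : ℕ) : ℝ) + 1) + 1))
      = fun _ => α * 1 := by
    ext k; push_cast; ring
  rw [h, mlSeries_const_mul]
  exact mul_nonneg hα0.le (mlKernel_nonneg hα0 hα1 ht)

theorem mlSeries_quadratic_nonneg (hα0 : 0 < α) (hα1 : α < 1) {t : ℝ} (ht : 0 < t) :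
    0 ≤ mlSeries α (fun k => (-α * ((k : ℝ) + 1) + 2) * (-α * ((k : ℝ) + 1) + 1)) t := by
  refine mlSeries_nonneg_of_diff hα0 hα1 ((PolyBdd.linear _ _).mul (PolyBdd.linear _ _))
    (by norm_num; nlinarith) (fun t ht => ?_) ht
  have h : (fun k : ℕ => (-α * ((k : ℝ) + 1) + 2) * (-α * ((k : ℝ) + 1) + 1)
        - (-α * (((k + 1 : ℕ) : ℝ) + 1) + 2) * (-α * (((k + 1 : ℕ) : ℝ) + 1) + 1))
      = fun k : ℕ => 2 * α * (-α * ((k : ℝ) + 1) + 1) - (-(α * (1 - α))) * 1 := by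
    ext k; push_cast; ring
  have hlin := PolyBdd.linear (-α) 1
  have h1 : PolyBdd (fun k : ℕ => 2 * α * (-α * ((k : ℝ) + 1) + 1)) := by
    simpa using (PolyBdd.linear 0 (2 * α)).mul hlin
  have h2 : PolyBdd (fun _ : ℕ => (-(α * (1 - α))) * 1) := by
    simpa using PolyBdd.linear 0 (-(α * (1 - α)))
  rw [h, mlSeries_sub hα0 hα1 h1 h2 ht, mlSeries_const_mul, mlSeries_const_mul]
  have h3 := mul_nonneg (by linarith : 0 ≤ 2 * α) (mlSeries_linear_nonneg hα0 hα1 ht)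
  have h4 : 0 ≤ α * (1 - α) * mlSeries α (fun _ => 1) t :=
    mul_nonneg (by nlinarith) (mlKernel_nonneg hα0 hα1 ht)
  linarith

theorem mlKernelSlope_nonneg (hα0 : 0 < α) (hα1 : α < 1) {t : ℝ} (ht : 0 < t) :
    0 ≤ mlKernelSlope α t :=
  mul_nonneg (inv_nonneg.2 ht.le) (mlSeries_linear_nonneg hα0 hα1 ht)

theorem hasDerivAt_mlKernel (hα0 : 0 < α) (hα1 : α < 1) {t : ℝ} (ht : 0 < t) :
    HasDerivAt (mlKernel α) (-mlKernelSlope α t) t := by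
  refine (hasDerivAt_mlSeries hα0 hα1 polyBdd_one ht).congr_deriv ?_
  rw [mlKernelSlope, ← mul_neg, ← mlSeries_neg]
  congr 2
  ext k; ring

theorem antitoneOn_mlKernelSlope (hα0 : 0 < α) (hα1 : α < 1) :
    AntitoneOn (mlKernelSlope α) (Ioi 0) := by
  have hlin := PolyBdd.linear (-α) 1
  have hd : ∀ t, 0 < t → HasDerivAt (mlKernelSlope α) (-(t⁻¹ * t⁻¹ *
      mlSeries α (fun k => (-α * ((k : ℝ) + 1) + 2) * (-α * ((k : ℝ) + 1) + 1)) t)) t := by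
    intro t ht
    refine ((hasDerivAt_inv ht.ne').mul (hasDerivAt_mlSeries hα0 hα1 hlin ht)).congr_deriv ?_
    have h : (fun k : ℕ => (-α * ((k : ℝ) + 1) + 2) * (-α * ((k : ℝ) + 1) + 1))
        = fun k : ℕ => (-α * ((k : ℝ) + 1) + 1)
          - (α * ((k : ℝ) + 1) + (-1)) * (-α * ((k : ℝ) + 1) + 1) := by
      ext k; ring
    rw [h, mlSeries_sub hα0 hα1 hlin ((PolyBdd.linear _ _).mul hlin) ht]
    field_simp
    ring
  apply antitoneOn_of_deriv_nonpos (convex_Ioi 0)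
  · exact fun t ht => (hd t ht).continuousAt.continuousWithinAt
  · rw [interior_Ioi]
    exact fun t ht => (hd t ht).differentiableAt.differentiableWithinAt
  · rw [interior_Ioi]
    intro t ht
    have ht' : 0 < t := ht
    rw [(hd t ht).deriv]
    have := mlSeries_quadratic_nonneg hα0 hα1 ht
    have : 0 ≤ t⁻¹ * t⁻¹ := by positivity
    simp only [Left.neg_nonpos_iff]
    positivity

theorem mlRelax_zero (α : ℝ) : mlRelax α 0 = 1 := by simp [mlRelax, mlPrimitive]

theorem hasDerivAt_mlRelax (hα0 : 0 < α) (hα1 : α < 1) {t : ℝ} (ht : 0 < t) :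
    HasDerivAt (mlRelax α) (-mlKernel α t) t := hasDerivAt_mlPrimitive hα0 hα1 polyBdd_one ht

theorem continuousOn_mlRelax (hα0 : 0 < α) (hα1 : α < 1) : ContinuousOn (mlRelax α) (Ici 0) := by
  intro t ht
  rcases (show 0 ≤ t from ht).eq_or_lt with h | h
  · rw [← h]
    have hd := (polyBdd_one.shift).div_linear hα0
    obtain ⟨C, hC, hb⟩ := abs_mlSeries_le hα0 hα1 hd 1
    have hlim : Tendsto (fun t : ℝ => C * t ^ α) (𝓝[≥] 0) (𝓝 0) := by
      have h1 : ContinuousAt (fun t : ℝ => C * t ^ α) 0 :=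
        continuousAt_const.mul (continuousAt_rpow_const _ _ (Or.inr hα0.le))
      have h2 := h1.tendsto
      simp only [zero_rpow hα0.ne', mul_zero] at h2
      exact h2.mono_left nhdsWithin_le_nhds
    have h3 : Tendsto (fun t => t * mlSeries α (fun k => 1 / (α * ((k : ℝ) + 1))) t) (𝓝[≥] 0)
        (𝓝 0) := by
      refine squeeze_zero_norm' ?_ hlim
      filter_upwards [Icc_mem_nhdsGE (one_pos : (0 : ℝ) < 1)] with s hs
      rcases hs.1.eq_or_lt with h0 | h0
      · simp [← h0, zero_rpow hα0.ne']
      · rw [norm_mul, norm_of_nonneg hs.1]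
        calc _ ≤ s * (C * s ^ (α - 1)) := by gcongr; exact hb s h0 hs.2
          _ = C * s ^ α := by rw [rpow_sub_one h0.ne']; field_simp
    have h4 := h3.const_sub 1
    rw [sub_zero] at h4
    rw [ContinuousWithinAt, mlRelax_zero]
    exact h4
  · exact (hasDerivAt_mlRelax hα0 hα1 h).continuousAt.continuousWithinAt

theorem intervalIntegrable_sub_rpow_mul_mlKernel (hα0 : 0 < α) (hα1 : α < 1) {t : ℝ}
    (ht : 0 < t) : IntervalIntegrable (fun s => (t - s) ^ (-α) * mlKernel α s) volume 0 t :=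
  intervalIntegrable_sub_rpow_mul_mlSeries hα0 hα1 polyBdd_one ht

theorem integral_sub_rpow_mul_mlKernel (hα0 : 0 < α) (hα1 : α < 1) {t : ℝ} (ht : 0 < t) :
    ∫ s in (0 : ℝ)..t, (t - s) ^ (-α) * mlKernel α s = Gamma (1 - α) * mlRelax α t :=
  integral_sub_rpow_mul_mlSeries hα0 hα1 polyBdd_one ht

theorem mlRelax_nonneg (hα0 : 0 < α) (hα1 : α < 1) {t : ℝ} (ht : 0 < t) : 0 ≤ mlRelax α t := by
  have h : 0 ≤ ∫ s in (0 : ℝ)..t, (t - s) ^ (-α) * mlKernel α s := by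
    rw [intervalIntegral.integral_of_le ht.le]
    refine setIntegral_nonneg measurableSet_Ioc fun s hs => ?_
    exact mul_nonneg (rpow_nonneg (by linarith [hs.2]) _) (mlKernel_nonneg hα0 hα1 hs.1)
  rw [integral_sub_rpow_mul_mlKernel hα0 hα1 ht] at h
  exact nonneg_of_mul_nonneg_right h (Gamma_pos_of_pos (by linarith))

theorem antitoneOn_mlRelax (hα0 : 0 < α) (hα1 : α < 1) : AntitoneOn (mlRelax α) (Ici 0) := by
  apply antitoneOn_of_deriv_nonpos (convex_Ici 0) (continuousOn_mlRelax hα0 hα1)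
  · rw [interior_Ici]
    exact fun t ht => (hasDerivAt_mlRelax hα0 hα1 ht).differentiableAt.differentiableWithinAt
  · rw [interior_Ici]
    intro t ht
    rw [(hasDerivAt_mlRelax hα0 hα1 ht).deriv]
    linarith [mlKernel_nonneg hα0 hα1 ht]

theorem mlRelax_le_one (hα0 : 0 < α) (hα1 : α < 1) {t : ℝ} (ht : 0 ≤ t) : mlRelax α t ≤ 1 := by
  rw [← mlRelax_zero α]
  exact antitoneOn_mlRelax hα0 hα1 self_mem_Ici ht ht

theorem one_sub_mlRelax_le (hα0 : 0 < α) (hα1 : α < 1) {t : ℝ} (ht : 0 < t) :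
    1 - mlRelax α t ≤ Gamma (1 - α) * t ^ α := by
  have hd : ∀ s, 0 < s → HasDerivAt (fun s => -mlRelax α s) (mlKernel α s) s := fun s hs =>
    (hasDerivAt_mlRelax hα0 hα1 hs).fun_neg.congr_deriv (neg_neg _)
  have hk : IntervalIntegrable (mlKernel α) volume 0 t := by
    have h := intervalIntegral.intervalIntegrable_deriv_of_nonneg (a := 0) (b := t)
      (g := fun s => -mlRelax α s) (g' := mlKernel α) ?_ ?_ ?_
    · exact h
    · rw [uIcc_of_le ht.le]
      exact ((continuousOn_mlRelax hα0 hα1).mono Icc_subset_Ici_self).neg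
    · intro s hs
      rw [min_eq_left ht.le] at hs
      exact hd s hs.1
    · intro s hs
      rw [min_eq_left ht.le] at hs
      exact mlKernel_nonneg hα0 hα1 hs.1
  have hint : ∫ s in (0 : ℝ)..t, mlKernel α s = 1 - mlRelax α t := by
    rw [intervalIntegral.integral_eq_sub_of_hasDerivAt_of_le (f := fun s => -mlRelax α s) ht.le
      ((continuousOn_mlRelax hα0 hα1).mono Icc_subset_Ici_self).neg
      (fun s hs => hd s hs.1) hk, mlRelax_zero]
    ring
  have hle : t ^ (-α) * ∫ s in (0 : ℝ)..t, mlKernel α s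
      ≤ ∫ s in (0 : ℝ)..t, (t - s) ^ (-α) * mlKernel α s := by
    rw [← intervalIntegral.integral_const_mul]
    apply intervalIntegral.integral_mono_on_of_le_Ioo ht.le (hk.const_mul _)
      (intervalIntegrable_sub_rpow_mul_mlKernel hα0 hα1 ht)
    intro s hs
    apply mul_le_mul_of_nonneg_right _ (mlKernel_nonneg hα0 hα1 hs.1)
    exact rpow_le_rpow_of_nonpos (by linarith [hs.2]) (by linarith [hs.1]) (by linarith)
  rw [hint, integral_sub_rpow_mul_mlKernel hα0 hα1 ht, rpow_neg ht.le,
    inv_mul_le_iff₀ (rpow_pos_of_pos ht α)] at hle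
  have h1 := mlRelax_le_one hα0 hα1 ht.le
  have h2 : 0 < Gamma (1 - α) * t ^ α :=
    mul_pos (Gamma_pos_of_pos (by linarith)) (rpow_pos_of_pos ht α)
  nlinarith

end

end MittagLeffler

namespace BackwardEulerCQ

open Real Set Filter Topology MeasureTheory MittagLeffler

section

variable {α : ℝ}

theorem succ_mul_cqWeight_succ (α : ℝ) (j : ℕ) :
    ((j : ℝ) + 1) * cqWeight α (j + 1) = (j - α) * cqWeight α j := by
  have h : ((Nat.factorial j : ℕ) : ℝ) ≠ 0 := by positivity
  have h1 : (j : ℝ) + 1 ≠ 0 := by positivity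
  simp only [cqWeight, Finset.prod_range_succ, Nat.factorial_succ, pow_succ]
  push_cast
  field_simp
  ring

/-- Partial sums of the weights. -/
noncomputable def cqSum (α : ℝ) (m : ℕ) : ℝ := ∑ j ∈ Finset.range (m + 1), cqWeight α j

theorem cqSum_zero (α : ℝ) : cqSum α 0 = 1 := by simp [cqSum, cqWeight]

theorem cqSum_succ (α : ℝ) (m : ℕ) : cqSum α (m + 1) = cqSum α m + cqWeight α (m + 1) := by
  rw [cqSum, Finset.sum_range_succ, cqSum]

theorem succ_mul_cqWeight_succ_eq_cqSum (α : ℝ) (m : ℕ) :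
    ((m : ℝ) + 1) * cqWeight α (m + 1) = -α * cqSum α m := by
  induction m with
  | zero => rw [succ_mul_cqWeight_succ, cqSum_zero]; simp [cqWeight]
  | succ m ih =>
    rw [succ_mul_cqWeight_succ, cqSum_succ]
    push_cast
    linear_combination ih

theorem succ_mul_cqSum_succ (α : ℝ) (m : ℕ) :
    ((m : ℝ) + 1) * cqSum α (m + 1) = (m + 1 - α) * cqSum α m := by
  rw [cqSum_succ]
  linear_combination succ_mul_cqWeight_succ_eq_cqSum α m

theorem sum_mul_cqWeight (α : ℝ) (m : ℕ) :
    (1 - α) * ∑ j ∈ Finset.range (m + 1), (j : ℝ) * cqWeight α j = -α * (m * cqSum α m) := by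
  induction m with
  | zero => simp
  | succ m ih =>
    rw [Finset.sum_range_succ]
    push_cast
    linear_combination ih + (1 - α) * succ_mul_cqWeight_succ_eq_cqSum α m
      + α * succ_mul_cqSum_succ α m

theorem Gamma_mul_cqSum (hα1 : α < 1) (m : ℕ) :
    Gamma (1 - α) * cqSum α m * Gamma (m + 1) = Gamma (m + (1 - α)) := by
  induction m with
  | zero => simp [cqSum_zero]
  | succ m ih =>
    have h1 : (m : ℝ) + (1 - α) ≠ 0 := by
      have : (0 : ℝ) ≤ m := Nat.cast_nonneg m
      linarith
    have h2 : (m : ℝ) + 1 ≠ 0 := by positivity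
    push_cast
    rw [Gamma_add_one h2, show (m : ℝ) + 1 + (1 - α) = m + (1 - α) + 1 by ring,
      Gamma_add_one h1, ← ih]
    linear_combination Gamma (1 - α) * Gamma (m + 1) * succ_mul_cqSum_succ α m

theorem Gamma_mul_cqSum_le (hα0 : 0 < α) (hα1 : α < 1) {m : ℕ} (hm : 1 ≤ m) :
    Gamma (1 - α) * cqSum α m ≤ (m : ℝ) ^ (-α) := by
  have hm0 : (0 : ℝ) < m := by exact_mod_cast hm
  have h := Gamma_add_le hm0 (by linarith : 0 < 1 - α) (by linarith)
  have hG : 0 < Gamma ((m : ℝ) + 1) := Gamma_pos_of_pos (by linarith)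
  rw [← Gamma_mul_cqSum hα1, sub_eq_add_neg, rpow_add hm0, rpow_one] at h
  refine le_of_mul_le_mul_right (h.trans_eq ?_) hG
  rw [Gamma_add_one hm0.ne']
  ring

theorem le_Gamma_mul_cqSum (hα0 : 0 < α) (hα1 : α < 1) {m : ℕ} (hm : 1 ≤ m) :
    ((m : ℝ) + 1) ^ (-α) ≤ Gamma (1 - α) * cqSum α m := by
  have hm0 : (0 : ℝ) < m := by exact_mod_cast hm
  have h := Gamma_add_one_le hm0 (by linarith : 0 < 1 - α) (by linarith)
  have hG : 0 < Gamma ((m : ℝ) + 1) := Gamma_pos_of_pos (by linarith)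
  rw [← Gamma_mul_cqSum hα1, sub_sub_cancel] at h
  have h1 : 0 < (m : ℝ) + (1 - α) := by linarith
  have h2 : ((m : ℝ) + 1) ^ (-α) ≤ (m + (1 - α)) ^ (-α) :=
    rpow_le_rpow_of_nonpos h1 (by linarith) (by linarith)
  refine h2.trans ?_
  rw [rpow_neg h1.le, inv_le_iff_one_le_mul₀' (rpow_pos_of_pos h1 α)]
  refine le_of_mul_le_mul_right ?_ hG
  linarith

theorem rpow_neg_sub_rpow_neg_succ_le (hα0 : 0 < α) (hα1 : α < 1) {x : ℝ} (hx : 0 < x) :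
    x ^ (-α) - (x + 1) ^ (-α) ≤ x ^ (-α - 1) := by
  have h1 : x ^ (1 - α) ≤ (x + 1) ^ (1 - α) := rpow_le_rpow hx.le (by linarith) (by linarith)
  have hx1 : 0 < x + 1 := by linarith
  rw [sub_eq_add_neg 1 α, rpow_add hx, rpow_add hx1, rpow_one, rpow_one] at h1
  rw [rpow_sub_one hx.ne', le_div_iff₀ hx]
  have h4 : (x + 1) ^ (-α) ≤ x ^ (-α) :=
    rpow_le_rpow_of_nonpos hx (by linarith) (by linarith)
  nlinarith

/-- The difference of the fractional kernel and its quadrature on the unit grid. -/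
noncomputable def cqKernel (α : ℝ) (n : ℕ) (r : ℝ) : ℝ :=
  r ^ (-α) / Gamma (1 - α) -
    ∑ j ∈ Finset.range (n + 1), cqWeight α j * if (j : ℝ) ≤ r then 1 else 0

/-- The primitive of `cqKernel` vanishing at zero. -/
noncomputable def cqKernelPrimitive (α : ℝ) (n : ℕ) (r : ℝ) : ℝ :=
  r ^ (1 - α) / ((1 - α) * Gamma (1 - α)) -
    ∑ j ∈ Finset.range (n + 1), cqWeight α j * max (r - j) 0

theorem sum_ite_cast_le {n : ℕ} {r : ℝ} (hr0 : 0 ≤ r) (hrn : r ≤ n) (F : ℕ → ℝ) :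
    ∑ j ∈ Finset.range (n + 1), (if (j : ℝ) ≤ r then F j else 0)
      = ∑ j ∈ Finset.range (⌊r⌋₊ + 1), F j := by
  rw [← Finset.sum_filter]
  congr 1
  ext j
  simp only [Finset.mem_filter, Finset.mem_range, Nat.lt_succ_iff]
  rw [Nat.le_floor_iff hr0]
  refine ⟨fun h => h.2, fun h => ⟨?_, h⟩⟩
  exact_mod_cast h.trans hrn

theorem cqKernel_eq {n : ℕ} {r : ℝ} (hr0 : 0 ≤ r) (hrn : r ≤ n) :
    cqKernel α n r = r ^ (-α) / Gamma (1 - α) - cqSum α ⌊r⌋₊ := by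
  simp only [cqKernel, mul_ite, mul_one, mul_zero, cqSum]
  rw [sum_ite_cast_le hr0 hrn]

theorem cqKernelPrimitive_eq (hα1 : α < 1) {n : ℕ} {r : ℝ} (hr0 : 0 < r) (hrn : r ≤ n) :
    (1 - α) * Gamma (1 - α) * cqKernelPrimitive α n r
      = r * (r ^ (-α) - Gamma (1 - α) * cqSum α ⌊r⌋₊)
        + α * (r - ⌊r⌋₊) * (Gamma (1 - α) * cqSum α ⌊r⌋₊) := by
  have h1 : 1 - α ≠ 0 := by linarith
  have h2 := (Gamma_pos_of_pos (by linarith : 0 < 1 - α)).ne'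
  have h3 : ∑ j ∈ Finset.range (n + 1), cqWeight α j * max (r - j) 0
      = r * cqSum α ⌊r⌋₊ - ∑ j ∈ Finset.range (⌊r⌋₊ + 1), (j : ℝ) * cqWeight α j := by
    rw [cqSum, Finset.mul_sum, ← Finset.sum_sub_distrib, ← sum_ite_cast_le hr0.le hrn]
    refine Finset.sum_congr rfl fun j _ => ?_
    split_ifs with h
    · rw [max_eq_left (by linarith)]; ring
    · rw [max_eq_right (by linarith), mul_zero]
  have h4 := sum_mul_cqWeight α ⌊r⌋₊
  have h5 : r ^ (1 - α) = r * r ^ (-α) := by rw [sub_eq_add_neg, rpow_add hr0, rpow_one]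
  rw [cqKernelPrimitive, h3, mul_sub, mul_div_cancel₀ _ (mul_ne_zero h1 h2), h5]
  linear_combination Gamma (1 - α) * h4

theorem half_le_floor {r : ℝ} (hr : 1 ≤ r) : r / 2 ≤ (⌊r⌋₊ : ℝ) := by
  have h1 : (1 : ℝ) ≤ ⌊r⌋₊ := by exact_mod_cast (Nat.one_le_floor_iff r).2 hr
  have h2 := Nat.lt_floor_add_one r
  linarith

theorem abs_rpow_sub_Gamma_mul_cqSum_le (hα0 : 0 < α) (hα1 : α < 1) {r : ℝ} (hr : 0 < r) :
    |r ^ (-α) - Gamma (1 - α) * cqSum α ⌊r⌋₊| ≤ (4 + Gamma (1 - α)) * r ^ (-α - 1) := by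
  have hG : 0 < Gamma (1 - α) := Gamma_pos_of_pos (by linarith)
  have hp : 0 < r ^ (-α - 1) := rpow_pos_of_pos hr _
  rcases lt_or_ge r 1 with h | h
  · rw [Nat.floor_eq_zero.2 h, cqSum_zero, mul_one]
    have h1 : r ^ (-α) ≤ r ^ (-α - 1) := rpow_le_rpow_of_exponent_ge hr h.le (by linarith)
    have h2 : 1 ≤ r ^ (-α - 1) := one_le_rpow_of_pos_of_le_one_of_nonpos hr h.le (by linarith)
    have h3 : 0 < r ^ (-α) := rpow_pos_of_pos hr _
    rw [abs_le]
    constructor <;> nlinarith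
  · have hm : 1 ≤ ⌊r⌋₊ := (Nat.one_le_floor_iff r).2 h
    have hm0 : (0 : ℝ) < ⌊r⌋₊ := by exact_mod_cast hm
    have h1 := Gamma_mul_cqSum_le hα0 hα1 hm
    have h2 := le_Gamma_mul_cqSum hα0 hα1 hm
    have h3 : r ^ (-α) ≤ (⌊r⌋₊ : ℝ) ^ (-α) :=
      rpow_le_rpow_of_nonpos hm0 (Nat.floor_le hr.le) (by linarith)
    have h4 : ((⌊r⌋₊ : ℝ) + 1) ^ (-α) ≤ r ^ (-α) :=
      rpow_le_rpow_of_nonpos hr (Nat.lt_floor_add_one r).le (by linarith)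
    have h5 := rpow_neg_sub_rpow_neg_succ_le hα0 hα1 hm0
    have h6 : (⌊r⌋₊ : ℝ) ^ (-α - 1) ≤ 4 * r ^ (-α - 1) := by
      calc (⌊r⌋₊ : ℝ) ^ (-α - 1) ≤ (r / 2) ^ (-α - 1) :=
            rpow_le_rpow_of_nonpos (by linarith) (half_le_floor h) (by linarith)
        _ = (2⁻¹) ^ (-α - 1) * r ^ (-α - 1) := by
          rw [← mul_rpow (by norm_num) hr.le]; congr 1; ring
        _ ≤ (2⁻¹) ^ (-2 : ℝ) * r ^ (-α - 1) := by
          gcongr ?_ * _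
          exact rpow_le_rpow_of_exponent_ge (by norm_num) (by norm_num) (by linarith)
        _ = 4 * r ^ (-α - 1) := by
          rw [rpow_neg (by norm_num)]; norm_num
    rw [abs_le]
    constructor <;> nlinarith

theorem Gamma_mul_cqSum_floor_le (hα0 : 0 < α) (hα1 : α < 1) {r : ℝ} (hr : 0 < r) :
    |Gamma (1 - α) * cqSum α ⌊r⌋₊| ≤ (2 + Gamma (1 - α)) * r ^ (-α) := by
  have hG : 0 < Gamma (1 - α) := Gamma_pos_of_pos (by linarith)
  have hp : 0 < r ^ (-α) := rpow_pos_of_pos hr _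
  rcases lt_or_ge r 1 with h | h
  · rw [Nat.floor_eq_zero.2 h, cqSum_zero, mul_one, abs_of_pos hG]
    have h2 : 1 ≤ r ^ (-α) := one_le_rpow_of_pos_of_le_one_of_nonpos hr h.le (by linarith)
    nlinarith
  · have hm : 1 ≤ ⌊r⌋₊ := (Nat.one_le_floor_iff r).2 h
    have hm0 : (0 : ℝ) < ⌊r⌋₊ := by exact_mod_cast hm
    have h1 := Gamma_mul_cqSum_le hα0 hα1 hm
    have h2 := le_Gamma_mul_cqSum hα0 hα1 hm
    have h3 : (⌊r⌋₊ : ℝ) ^ (-α) ≤ 2 * r ^ (-α) := by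
      calc (⌊r⌋₊ : ℝ) ^ (-α) ≤ (r / 2) ^ (-α) :=
            rpow_le_rpow_of_nonpos (by linarith) (half_le_floor h) (by linarith)
        _ = (2⁻¹) ^ (-α) * r ^ (-α) := by
          rw [← mul_rpow (by norm_num) hr.le]; congr 1; ring
        _ ≤ (2⁻¹) ^ (-1 : ℝ) * r ^ (-α) := by
          gcongr ?_ * _
          exact rpow_le_rpow_of_exponent_ge (by norm_num) (by norm_num) (by linarith)
        _ = 2 * r ^ (-α) := by
          rw [rpow_neg (by norm_num)]; norm_num
    have h4 : 0 < ((⌊r⌋₊ : ℝ) + 1) ^ (-α) := rpow_pos_of_pos (by linarith) _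
    rw [abs_of_pos (by linarith)]
    nlinarith

theorem abs_cqKernel_le (hα0 : 0 < α) (hα1 : α < 1) :
    ∃ C, 0 < C ∧ ∀ (n : ℕ) (r : ℝ), 0 < r → r ≤ n →
      |cqKernel α n r| ≤ C * r ^ (-α - 1) ∧ |cqKernelPrimitive α n r| ≤ C * r ^ (-α) := by
  have hG : 0 < Gamma (1 - α) := Gamma_pos_of_pos (by linarith)
  have h1α : 0 < 1 - α := by linarith
  refine ⟨(6 + 2 * Gamma (1 - α)) / ((1 - α) * Gamma (1 - α)), by positivity,
    fun n r hr hrn => ⟨?_, ?_⟩⟩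
  · have h := abs_rpow_sub_Gamma_mul_cqSum_le hα0 hα1 hr
    have hp : 0 < r ^ (-α - 1) := rpow_pos_of_pos hr _
    have h1 : cqKernel α n r = (r ^ (-α) - Gamma (1 - α) * cqSum α ⌊r⌋₊) / Gamma (1 - α) := by
      rw [cqKernel_eq hr.le hrn]; field_simp
    rw [h1, abs_div, abs_of_pos hG, div_le_iff₀ hG]
    refine h.trans ?_
    have h2 : (6 + 2 * Gamma (1 - α)) / ((1 - α) * Gamma (1 - α)) * r ^ (-α - 1) * Gamma (1 - α)
        = (6 + 2 * Gamma (1 - α)) * r ^ (-α - 1) / (1 - α) := by field_simp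
    rw [h2, le_div_iff₀ h1α]
    calc (4 + Gamma (1 - α)) * r ^ (-α - 1) * (1 - α)
        ≤ (4 + Gamma (1 - α)) * r ^ (-α - 1) * 1 := by gcongr; linarith
      _ ≤ (6 + 2 * Gamma (1 - α)) * r ^ (-α - 1) := by rw [mul_one]; gcongr <;> linarith
  · have h1 := abs_rpow_sub_Gamma_mul_cqSum_le hα0 hα1 hr
    have h2 := Gamma_mul_cqSum_floor_le hα0 hα1 hr
    have hpos : 0 < (1 - α) * Gamma (1 - α) := by positivity
    have h3 : |(1 - α) * Gamma (1 - α) * cqKernelPrimitive α n r|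
        ≤ (6 + 2 * Gamma (1 - α)) * r ^ (-α) := by
      rw [cqKernelPrimitive_eq hα1 hr hrn]
      have hf1 := Nat.floor_le hr.le
      have hf2 := Nat.lt_floor_add_one r
      have h4 : 0 ≤ α * (r - ⌊r⌋₊) := mul_nonneg hα0.le (by linarith)
      have h5 : α * (r - ⌊r⌋₊) ≤ 1 := by nlinarith
      calc _ ≤ r * |r ^ (-α) - Gamma (1 - α) * cqSum α ⌊r⌋₊|
            + α * (r - ⌊r⌋₊) * |Gamma (1 - α) * cqSum α ⌊r⌋₊| := by
            refine (abs_add_le _ _).trans_eq ?_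
            rw [abs_mul, abs_mul _ (Gamma (1 - α) * cqSum α ⌊r⌋₊), abs_of_pos hr, abs_of_nonneg h4]
        _ ≤ r * ((4 + Gamma (1 - α)) * r ^ (-α - 1)) + 1 * ((2 + Gamma (1 - α)) * r ^ (-α)) := by
            gcongr
        _ = _ := by
            rw [rpow_sub_one hr.ne']; field_simp; ring
    rw [abs_mul, abs_of_pos hpos] at h3
    rw [div_mul_eq_mul_div, le_div_iff₀ hpos]
    linarith

theorem continuous_cqKernelPrimitive (hα1 : α < 1) (n : ℕ) :
    Continuous (cqKernelPrimitive α n) := by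
  unfold cqKernelPrimitive
  apply Continuous.sub
  · exact (continuous_id.rpow_const fun _ => Or.inr (by linarith)).div_const _
  · fun_prop

theorem hasDerivWithinAt_max_sub (j r : ℝ) :
    HasDerivWithinAt (fun x => max (x - j) 0) (if j ≤ r then 1 else 0) (Ioi r) r := by
  split_ifs with h
  · refine (((hasDerivAt_id r).sub_const j).hasDerivWithinAt).congr (fun x hx => ?_) ?_
    · have hx' : r < x := hx
      exact max_eq_left (by linarith)
    · exact max_eq_left (by simpa using h)
  · apply HasDerivAt.hasDerivWithinAt
    refine (hasDerivAt_const r (0 : ℝ)).congr_of_eventuallyEq ?_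
    filter_upwards [gt_mem_nhds (not_le.1 h)] with x hx
    exact max_eq_right (by linarith)

theorem hasDerivWithinAt_cqKernelPrimitive (hα1 : α < 1) (n : ℕ) {r : ℝ} (hr : 0 < r) :
    HasDerivWithinAt (cqKernelPrimitive α n) (cqKernel α n r) (Ioi r) r := by
  have h1 := ((Real.hasDerivAt_rpow_const (x := r) (p := 1 - α) (Or.inl hr.ne')).div_const
    ((1 - α) * Gamma (1 - α))).hasDerivWithinAt (s := Ioi r)
  have h2 := HasDerivWithinAt.fun_sum (u := Finset.range (n + 1))
    (A := fun (j : ℕ) (x : ℝ) => cqWeight α j * max (x - (j : ℝ)) 0)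
    (fun j _ => (hasDerivWithinAt_max_sub (j : ℝ) r).const_mul (cqWeight α j))
  refine (h1.sub h2).congr_deriv ?_
  have h3 : 1 - α ≠ 0 := by linarith
  rw [cqKernel, show 1 - α - 1 = -α by ring, mul_div_mul_left _ _ h3]

theorem cqKernelPrimitive_zero (hα1 : α < 1) (n : ℕ) : cqKernelPrimitive α n 0 = 0 := by
  simp [cqKernelPrimitive, zero_rpow (by linarith : 1 - α ≠ 0)]

end

section

variable {α : ℝ} {f g h : ℝ → ℝ}

theorem mul_le_sub_of_hasDerivAt_neg {a b : ℝ} (hab : a < b) (hc : ContinuousOn f (Icc a b))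
    (hd : ∀ x ∈ Ioo a b, HasDerivAt f (-g x) x) (hg : ∀ x ∈ Ioo a b, g b ≤ g x) :
    (b - a) * g b ≤ f a - f b := by
  obtain ⟨c, hc1, hc2⟩ := exists_hasDerivAt_eq_slope f (fun x => -g x) hab hc hd
  have h1 := hg c hc1
  have h2 : 0 < b - a := by linarith
  rw [eq_div_iff h2.ne'] at hc2
  nlinarith

theorem antitoneOn_of_hasDerivAt_neg {s : Set ℝ} (hs : Convex ℝ s) (hc : ContinuousOn f s)
    (hd : ∀ x ∈ interior s, HasDerivAt f (-g x) x) (hg : ∀ x ∈ interior s, 0 ≤ g x) :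
    AntitoneOn f s := by
  refine antitoneOn_of_deriv_nonpos hs hc
    (fun x hx => (hd x hx).differentiableAt.differentiableWithinAt) fun x hx => ?_
  rw [(hd x hx).deriv]
  linarith [hg x hx]

theorem hasDerivAt_comp_sub {N r : ℝ} (hd : HasDerivAt f (-g (N - r)) (N - r)) :
    HasDerivAt (fun r => f (N - r)) (g (N - r)) r := by
  have h := hd.comp r ((hasDerivAt_id r).const_sub N)
  simpa [Function.comp_def] using h

theorem integral_reflect {N : ℝ} (hc : ContinuousOn f (Ici 0))
    (hd : ∀ x, 0 < x → HasDerivAt f (-g x) x) (hg : ∀ x, 0 < x → 0 ≤ g x)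
    {a : ℝ} (haN : a ≤ N) :
    IntervalIntegrable (fun r => g (N - r)) volume a N ∧
      ∫ r in a..N, g (N - r) = f 0 - f (N - a) := by
  have hcN : ContinuousOn (fun r => f (N - r)) (Icc a N) :=
    hc.comp (by fun_prop) fun r hr => by simpa using hr.2
  have hdN : ∀ r ∈ Ioo a N, HasDerivAt (fun r => f (N - r)) (g (N - r)) r := fun r hr =>
    hasDerivAt_comp_sub (hd _ (by linarith [hr.2]))
  have hi : IntervalIntegrable (fun r => g (N - r)) volume a N := by
    refine intervalIntegral.intervalIntegrable_deriv_of_nonneg (g := fun r => f (N - r)) ?_ ?_ ?_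
    · rwa [uIcc_of_le haN]
    · rwa [min_eq_left haN, max_eq_right haN]
    · rw [min_eq_left haN, max_eq_right haN]
      exact fun r hr => hg _ (by linarith [hr.2])
  refine ⟨hi, ?_⟩
  rw [intervalIntegral.integral_eq_sub_of_hasDerivAt_of_le haN hcN hdN hi, sub_self]

theorem integral_ite_reflect {N : ℝ} (hN : 0 ≤ N) (hc : ContinuousOn f (Ici 0))
    (hd : ∀ x, 0 < x → HasDerivAt f (-g x) x) (hg : ∀ x, 0 < x → 0 ≤ g x)
    {a : ℝ} (ha : 0 ≤ a) (haN : a ≤ N) :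
    IntervalIntegrable (fun r => (if a ≤ r then 1 else 0) * g (N - r)) volume 0 N ∧
      ∫ r in (0 : ℝ)..N, (if a ≤ r then 1 else 0) * g (N - r) = f 0 - f (N - a) := by
  have hi := (integral_reflect hc hd hg hN).1
  have heq : (fun r => (if a ≤ r then 1 else 0) * g (N - r))
      = (Ici a).indicator fun r => g (N - r) := by
    ext r
    by_cases h : a ≤ r <;> simp [h]
  have hi2 : IntervalIntegrable (fun r => (if a ≤ r then 1 else 0) * g (N - r)) volume 0 N := by
    rw [heq, intervalIntegrable_iff] at *
    exact hi.indicator measurableSet_Ici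
  refine ⟨hi2, ?_⟩
  have hcN : ContinuousOn (fun r => f (N - max r a)) (Icc 0 N) :=
    hc.comp (by fun_prop) fun r hr => by simpa using ⟨hr.2, haN⟩
  rw [intervalIntegral.integral_eq_sub_of_hasDeriv_right_of_le hN hcN (fun r hr => ?_) hi2]
  · simp [haN, ha]
  split_ifs with h
  · rw [one_mul]
    refine (hasDerivAt_comp_sub (hd _ (by linarith [hr.2]))).hasDerivWithinAt.congr
      (fun x hx => ?_) ?_
    · rw [max_eq_left (h.trans (le_of_lt hx))]
    · rw [max_eq_left h]
  · rw [zero_mul]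
    apply HasDerivAt.hasDerivWithinAt
    refine (hasDerivAt_const r (f (N - a))).congr_of_eventuallyEq ?_
    filter_upwards [gt_mem_nhds (not_le.1 h)] with x hx
    rw [max_eq_right (by linarith)]

theorem integral_cqKernel_mul (n : ℕ) (hc : ContinuousOn f (Ici 0))
    (hd : ∀ x, 0 < x → HasDerivAt f (-g x) x) (hg : ∀ x, 0 < x → 0 ≤ g x)
    (hi : IntervalIntegrable (fun s => ((n : ℝ) - s) ^ (-α) * g s) volume 0 n) :
    IntervalIntegrable (fun r => cqKernel α n r * g (n - r)) volume 0 n ∧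
      (1 / Gamma (1 - α)) * (∫ s in (0 : ℝ)..n, ((n : ℝ) - s) ^ (-α) * (-g s))
        - ∑ j ∈ Finset.range (n + 1), cqWeight α j * (f (n - j) - f 0)
        = -∫ r in (0 : ℝ)..n, cqKernel α n r * g (n - r) := by
  have hn : (0 : ℝ) ≤ n := Nat.cast_nonneg n
  have hi1 : IntervalIntegrable (fun r => r ^ (-α) * g (n - r)) volume 0 n := by
    have := (hi.comp_sub_left (n : ℝ)).symm
    simpa using this
  have hI1 : ∫ r in (0 : ℝ)..n, r ^ (-α) * g (n - r)
      = ∫ s in (0 : ℝ)..n, ((n : ℝ) - s) ^ (-α) * g s := by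
    have := intervalIntegral.integral_comp_sub_left (a := 0) (b := n)
      (fun s => ((n : ℝ) - s) ^ (-α) * g s) (n : ℝ)
    simpa using this
  have hj : ∀ j ∈ Finset.range (n + 1), (j : ℝ) ≤ n := fun j hj => by
    exact_mod_cast Nat.lt_succ_iff.1 (Finset.mem_range.1 hj)
  have hi2 : ∀ j ∈ Finset.range (n + 1), IntervalIntegrable
      (fun r => cqWeight α j * ((if (j : ℝ) ≤ r then 1 else 0) * g (n - r))) volume 0 n :=
    fun j h => (integral_ite_reflect hn hc hd hg (Nat.cast_nonneg j) (hj j h)).1.const_mul _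
  have hi2' := IntervalIntegrable.sum (Finset.range (n + 1)) hi2
  have hi1' := hi1.const_mul (1 / Gamma (1 - α))
  have heq : ∀ r, cqKernel α n r * g (n - r) = 1 / Gamma (1 - α) * (r ^ (-α) * g (n - r))
      - ∑ j ∈ Finset.range (n + 1),
        cqWeight α j * ((if (j : ℝ) ≤ r then 1 else 0) * g (n - r)) := fun r => by
    rw [cqKernel, sub_mul, Finset.sum_mul]
    congr 1
    · ring
    · exact Finset.sum_congr rfl fun j _ => by ring
  simp only [heq]
  have hi3 : IntervalIntegrable (fun r => ∑ j ∈ Finset.range (n + 1),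
        cqWeight α j * ((if (j : ℝ) ≤ r then 1 else 0) * g (n - r))) volume 0 n := by
    simpa only [Finset.sum_fn] using hi2'
  refine ⟨hi1'.sub hi3, ?_⟩
  rw [intervalIntegral.integral_sub hi1' hi3, intervalIntegral.integral_finsetSum hi2,
    intervalIntegral.integral_const_mul, hI1]
  have h1 : ∑ j ∈ Finset.range (n + 1), ∫ r in (0 : ℝ)..n,
        cqWeight α j * ((if (j : ℝ) ≤ r then 1 else 0) * g (n - r))
      = -∑ j ∈ Finset.range (n + 1), cqWeight α j * (f (n - j) - f 0) := by
    rw [← Finset.sum_neg_distrib]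
    refine Finset.sum_congr rfl fun j h => ?_
    rw [intervalIntegral.integral_const_mul,
      (integral_ite_reflect hn hc hd hg (Nat.cast_nonneg j) (hj j h)).2]
    ring
  rw [h1]
  simp only [mul_neg, intervalIntegral.integral_neg]
  ring

theorem abs_integral_cqKernel_mul_far_le {C : ℝ} {n : ℕ} {M : ℝ} (hM : 0 < M) (hn : (n : ℝ) = 2 * M)
    (hC : ∀ r : ℝ, 0 < r → r ≤ n → |cqKernel α n r| ≤ C * r ^ (-α - 1))
    (hα0 : 0 < α) (hC0 : 0 < C) (hc : ContinuousOn f (Ici 0))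
    (hd : ∀ x, 0 < x → HasDerivAt f (-g x) x) (hg : ∀ x, 0 < x → 0 ≤ g x) :
    |∫ r in M..n, cqKernel α n r * g (n - r)| ≤ C * M ^ (-α - 1) * (f 0 - f M) := by
  have hMn : M ≤ n := by linarith
  obtain ⟨hi, hI⟩ := integral_reflect (N := n) hc hd hg hMn
  have h1 : ∀ᵐ r, r ∈ Ioc M n → ‖cqKernel α n r * g (n - r)‖ ≤ C * M ^ (-α - 1) * g (n - r) := by
    filter_upwards [Measure.ae_ne volume (n : ℝ)] with r hrn hr
    have hrn' : r < n := lt_of_le_of_ne hr.2 hrn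
    have hr0 : 0 < r := hM.trans hr.1
    have hg0 := hg (n - r) (by linarith)
    rw [norm_mul, norm_eq_abs, norm_of_nonneg hg0]
    gcongr
    refine (hC r hr0 hr.2).trans ?_
    gcongr ?_ * ?_
    exact rpow_le_rpow_of_nonpos hM hr.1.le (by linarith)
  have h2 := intervalIntegral.norm_integral_le_of_norm_le hMn h1 (hi.const_mul _)
  rw [intervalIntegral.integral_const_mul, hI, hn] at h2
  rw [← norm_eq_abs, hn]
  convert h2 using 4
  ring

theorem abs_integral_cqKernel_mul_near_le {C : ℝ} {n : ℕ} {M : ℝ} (hM : 0 < M)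
    (hn : (n : ℝ) = 2 * M)
    (hC : ∀ r : ℝ, 0 < r → r ≤ n → |cqKernelPrimitive α n r| ≤ C * r ^ (-α))
    (hα1 : α < 1) (hC0 : 0 < C)
    (hdg : ∀ x, 0 < x → HasDerivAt g (-h x) x) (hg : ∀ x, 0 < x → 0 ≤ g x)
    (hh : ∀ x, 0 < x → 0 ≤ h x) (hanti : AntitoneOn h (Ioi 0))
    (hi : IntervalIntegrable (fun r => cqKernel α n r * g (n - r)) volume 0 n) :
    |∫ r in (0 : ℝ)..M, cqKernel α n r * g (n - r)|
      ≤ C * M ^ (-α) * g M + C * h M * (M ^ (1 - α) / (1 - α)) := by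
  have hi1 : IntervalIntegrable (fun r => cqKernel α n r * g (n - r)) volume 0 M :=
    hi.mono_set (by rw [uIcc_of_le hM.le, uIcc_of_le (by linarith)]; gcongr; linarith)
  have hi2 : IntervalIntegrable (fun r => cqKernelPrimitive α n r * h (n - r)) volume 0 M := by
    refine IntervalIntegrable.continuousOn_mul ?_ (continuous_cqKernelPrimitive hα1 n).continuousOn
    apply MonotoneOn.intervalIntegrable
    rw [uIcc_of_le hM.le]
    intro x hx y hy hxy
    exact hanti (by simp only [mem_Ioi]; linarith [hy.2]) (by simp only [mem_Ioi]; linarith [hx.2])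
      (by linarith)
  have hcont : ContinuousOn (fun r => cqKernelPrimitive α n r * g (n - r)) (Icc 0 M) := by
    refine (continuous_cqKernelPrimitive hα1 n).continuousOn.mul fun r hr => ?_
    have := hasDerivAt_comp_sub (N := n) (r := r) (hdg _ (by linarith [hr.2]))
    exact this.continuousAt.continuousWithinAt
  have hder : ∀ r ∈ Ioo 0 M, HasDerivWithinAt (fun r => cqKernelPrimitive α n r * g (n - r))
      (cqKernel α n r * g (n - r) + cqKernelPrimitive α n r * h (n - r)) (Ioi r) r := fun r hr =>
    (hasDerivWithinAt_cqKernelPrimitive hα1 n hr.1).mul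
      (hasDerivAt_comp_sub (N := n) (r := r) (hdg _ (by linarith [hr.2]))).hasDerivWithinAt
  have hI := intervalIntegral.integral_eq_sub_of_hasDeriv_right_of_le hM.le hcont hder (hi1.add hi2)
  rw [intervalIntegral.integral_add hi1 hi2, cqKernelPrimitive_zero hα1, zero_mul, sub_zero,
    show (n : ℝ) - M = M by linarith] at hI
  rw [eq_sub_of_add_eq hI]
  refine (abs_sub _ _).trans (add_le_add ?_ ?_)
  · rw [abs_mul, abs_of_nonneg (hg M hM)]
    exact mul_le_mul_of_nonneg_right (hC M hM (by linarith)) (hg M hM)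
  have h1 : ∀ᵐ r, r ∈ Ioc 0 M →
      ‖cqKernelPrimitive α n r * h (n - r)‖ ≤ C * h M * r ^ (-α) := by
    refine Eventually.of_forall fun r hr => ?_
    have hr1 : M ≤ n - r := by linarith [hr.2]
    have h0 := hh (n - r) (by linarith)
    rw [norm_mul, norm_eq_abs, norm_of_nonneg h0]
    calc _ ≤ (C * r ^ (-α)) * h M := by
          have := hC r hr.1 (by linarith [hr.2])
          have hp : 0 ≤ r ^ (-α) := rpow_nonneg hr.1.le _
          gcongr
          exact hanti hM (hM.trans_le hr1) hr1
      _ = _ := by ring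
  have h2 := intervalIntegral.norm_integral_le_of_norm_le hM.le h1
    ((intervalIntegral.intervalIntegrable_rpow' (by linarith)).const_mul _)
  rwa [intervalIntegral.integral_const_mul, integral_rpow (Or.inl (by linarith)),
    show -α + 1 = 1 - α by ring, zero_rpow (by linarith), sub_zero, norm_eq_abs] at h2

theorem cq_consistency_unit_step (hα0 : 0 < α) (hα1 : α < 1) :
    ∃ C, 0 < C ∧ ∀ f g h : ℝ → ℝ, ContinuousOn f (Ici 0) →
      (∀ x, 0 < x → HasDerivAt f (-g x) x) → (∀ x, 0 < x → HasDerivAt g (-h x) x) →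
      (∀ x, 0 < x → 0 ≤ g x) → (∀ x, 0 < x → 0 ≤ h x) → AntitoneOn h (Ioi 0) →
      ∀ n : ℕ, 1 ≤ n → IntervalIntegrable (fun s => ((n : ℝ) - s) ^ (-α) * g s) volume 0 n →
      |(1 / Gamma (1 - α)) * (∫ s in (0 : ℝ)..n, ((n : ℝ) - s) ^ (-α) * (-g s))
        - ∑ j ∈ Finset.range (n + 1), cqWeight α j * (f (n - j) - f 0)|
        ≤ C * (n : ℝ) ^ (-1 - α) * (f 0 - f n) := by
  obtain ⟨C, hC0, hC⟩ := abs_cqKernel_le hα0 hα1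
  have h1α : 0 < 1 - α := by linarith
  refine ⟨4 * (C * (2 + 4 / (1 - α))), by positivity,
    fun f g h hc hd hdg hg hh hanti n hn hi => ?_⟩
  obtain ⟨hi1, hI⟩ := integral_cqKernel_mul n hc hd hg hi
  have hn1 : (1 : ℝ) ≤ n := by exact_mod_cast hn
  obtain ⟨M, hM⟩ : ∃ M : ℝ, (n : ℝ) = 2 * M := ⟨n / 2, by ring⟩
  have hM0 : 0 < M := by linarith
  have hfar := abs_integral_cqKernel_mul_far_le hM0 hM
    (fun (r : ℝ) h1 h2 => (hC n r h1 h2).1) hα0 hC0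
    hc hd hg
  have hnear := abs_integral_cqKernel_mul_near_le hM0 hM
    (fun (r : ℝ) h1 h2 => (hC n r h1 h2).2) hα1 hC0
    hdg hg hh hanti hi1
  have hfa : AntitoneOn f (Ici 0) := antitoneOn_of_hasDerivAt_neg (convex_Ici 0) hc
    (by simpa using hd) (by simpa using hg)
  have hgc : ContinuousOn g (Ioi 0) := fun x hx => (hdg x hx).continuousAt.continuousWithinAt
  have hga : AntitoneOn g (Ioi 0) := antitoneOn_of_hasDerivAt_neg (convex_Ioi 0) hgc
    (by simpa using hdg) (by simpa using hh)
  set D := f 0 - f n with hD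
  have hfD : ∀ x : ℝ, 0 ≤ x → x ≤ n → f 0 - f x ≤ D := fun x hx hxn => by
    have := hfa hx (hx.trans hxn) hxn
    linarith
  have hgD : ∀ x : ℝ, 0 < x → x ≤ n → x * g x ≤ D := fun x hx hxn => by
    have := mul_le_sub_of_hasDerivAt_neg hx (hc.mono Icc_subset_Ici_self)
      (fun y hy => hd y hy.1) (fun y hy => hga hy.1 hx hy.2.le)
    rw [sub_zero] at this
    exact this.trans (hfD x hx.le hxn)
  have hhD : M * M * h M ≤ 4 * D := by
    have h1 := mul_le_sub_of_hasDerivAt_neg (f := g) (g := h) (a := M / 2) (b := M) (by linarith)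
      (hgc.mono fun y hy => lt_of_lt_of_le (by linarith) hy.1)
      (fun y hy => hdg y (by linarith [hy.1]))
      (fun y hy => hanti (lt_trans (by linarith) hy.1) hM0 hy.2.le)
    have h2 := hgD (M / 2) (by linarith) (by linarith)
    have h3 := hg M hM0
    nlinarith
  have hgM := hgD M hM0 (by linarith)
  have hfM := hfD M hM0.le (by linarith)
  have hD0 : 0 ≤ D := by simpa using hfD 0 le_rfl (by linarith)
  have hMM : C * M ^ (-α) = C * M ^ (-α - 1) * M := by
    rw [rpow_sub_one hM0.ne']; field_simp
  have hMM2 : M ^ (1 - α) = M ^ (-α - 1) * (M * M) := by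
    rw [show 1 - α = -α - 1 + 1 + 1 by ring, rpow_add_one hM0.ne', rpow_add_one hM0.ne', mul_assoc]
  have hP : 0 < M ^ (-α - 1) := rpow_pos_of_pos hM0 _
  have hMn : M ^ (-α - 1) ≤ 4 * (n : ℝ) ^ (-1 - α) := by
    have h1 : M = 2⁻¹ * n := by rw [hM]; ring
    rw [h1, mul_rpow (by norm_num) (by linarith), show -1 - α = -α - 1 by ring]
    gcongr ?_ * _
    calc (2⁻¹ : ℝ) ^ (-α - 1) ≤ (2⁻¹) ^ (-2 : ℝ) :=
          rpow_le_rpow_of_exponent_ge (by norm_num) (by norm_num) (by linarith)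
      _ = 4 := by rw [rpow_neg (by norm_num)]; norm_num
  have hi2 : IntervalIntegrable (fun r => cqKernel α n r * g (n - r)) volume 0 M :=
    hi1.mono_set (by rw [uIcc_of_le hM0.le, uIcc_of_le (by linarith)]; gcongr; linarith)
  have hi3 : IntervalIntegrable (fun r => cqKernel α n r * g (n - r)) volume M n :=
    hi1.mono_set (by rw [uIcc_of_le (by linarith), uIcc_of_le (by linarith)]; gcongr)
  rw [hI, abs_neg, ← intervalIntegral.integral_add_adjacent_intervals hi2 hi3]
  calc _ ≤ (C * M ^ (-α) * g M + C * h M * (M ^ (1 - α) / (1 - α)))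
        + C * M ^ (-α - 1) * (f 0 - f M) := (abs_add_le _ _).trans (add_le_add hnear hfar)
    _ = C * M ^ (-α - 1) * (M * g M + M * M * h M / (1 - α) + (f 0 - f M)) := by
        rw [hMM, hMM2]; ring
    _ ≤ C * M ^ (-α - 1) * (D + 4 * D / (1 - α) + D) := by gcongr
    _ = C * (2 + 4 / (1 - α)) * D * M ^ (-α - 1) := by ring
    _ ≤ C * (2 + 4 / (1 - α)) * D * (4 * (n : ℝ) ^ (-1 - α)) := by gcongr
    _ = _ := by ring

end

section

variable {α : ℝ}

theorem hasDerivAt_comp_mul {f g : ℝ → ℝ} (hd : ∀ x, 0 < x → HasDerivAt f (-g x) x) {σ : ℝ}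
    (hσ : 0 < σ) {x : ℝ} (hx : 0 < x) : HasDerivAt (fun x => f (σ * x)) (-(σ * g (σ * x))) x := by
  have h := (hd _ (mul_pos hσ hx)).comp x ((hasDerivAt_id x).const_mul σ)
  refine h.congr_deriv ?_
  ring

theorem continuousOn_mlRelax_mul (hα0 : 0 < α) (hα1 : α < 1) {σ : ℝ} (hσ : 0 < σ) :
    ContinuousOn (fun t => mlRelax α (σ * t)) (Ici 0) :=
  (continuousOn_mlRelax hα0 hα1).comp (by fun_prop) fun _ hx => mul_nonneg hσ.le hx

theorem integral_sub_rpow_mul_mlKernel_mul (hα0 : 0 < α) (hα1 : α < 1) {σ t : ℝ}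
    (hσ : 0 < σ) (ht : 0 < t) :
    IntervalIntegrable (fun s => (t - s) ^ (-α) * (σ * mlKernel α (σ * s))) volume 0 t ∧
      ∫ s in (0 : ℝ)..t, (t - s) ^ (-α) * (σ * mlKernel α (σ * s))
        = σ ^ α * Gamma (1 - α) * mlRelax α (σ * t) := by
  have hσt := mul_pos hσ ht
  have heq : EqOn (fun s => σ ^ α * (σ * ((σ * t - σ * s) ^ (-α) * mlKernel α (σ * s))))
      (fun s => (t - s) ^ (-α) * (σ * mlKernel α (σ * s))) (uIcc 0 t) := fun s hs => by
    rw [uIcc_of_le ht.le] at hs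
    have h1 : σ ^ α * σ ^ (-α) = 1 := by rw [← rpow_add hσ, add_neg_cancel, rpow_zero]
    simp only [← mul_sub]
    rw [mul_rpow hσ.le (by linarith [hs.2])]
    linear_combination (t - s) ^ (-α) * (σ * mlKernel α (σ * s)) * h1
  have hi := (intervalIntegrable_sub_rpow_mul_mlKernel hα0 hα1 hσt).comp_mul_left (c := σ)
  rw [zero_div, mul_div_cancel_left₀ _ hσ.ne'] at hi
  refine ⟨((hi.const_mul σ).const_mul (σ ^ α)).congr (heq.mono uIoc_subset_uIcc), ?_⟩
  rw [← intervalIntegral.integral_congr heq, intervalIntegral.integral_const_mul,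
    intervalIntegral.integral_const_mul, intervalIntegral.mul_integral_comp_mul_left σ
      (f := fun x => (σ * t - x) ^ (-α) * mlKernel α x), mul_zero,
    integral_sub_rpow_mul_mlKernel hα0 hα1 hσt, mul_assoc]

theorem one_sub_mlRelax_mul_le_rpow (hα0 : 0 < α) (hα1 : α < 1) {β : ℝ} (hβ0 : 0 ≤ β) (hβ1 : β ≤ 1)
    {t : ℝ} (ht : 0 < t) :
    1 - mlRelax α t ≤ (1 + Gamma (1 - α)) * (t ^ α) ^ β := by
  have hG : 0 < Gamma (1 - α) := Gamma_pos_of_pos (by linarith)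
  have hx : 0 < t ^ α := rpow_pos_of_pos ht α
  have hxβ : 0 < (t ^ α) ^ β := rpow_pos_of_pos hx β
  rcases le_total 1 (t ^ α) with h | h
  · have h1 := one_le_rpow h hβ0
    have h2 := mlRelax_nonneg hα0 hα1 ht
    nlinarith
  · have h1 := rpow_le_rpow_of_exponent_ge hx h hβ1
    rw [rpow_one] at h1
    have h2 := one_sub_mlRelax_le hα0 hα1 ht
    nlinarith

/-- The consistency estimate for the relaxation function of a single mode `lam`. -/
theorem cq_consistency_mlRelax (hα0 : 0 < α) (hα1 : α < 1) {β : ℝ} (hβ0 : 0 ≤ β) (hβ1 : β ≤ 1) :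
    ∃ c, 0 < c ∧ ∀ lam τ : ℝ, 0 < lam → 0 < τ → ∀ n : ℕ, 1 ≤ n →
      lam ^ (-β) * |-lam * mlRelax α (lam ^ (1 / α) * (n * τ)) - τ ^ (-α) *
        ∑ j ∈ Finset.range (n + 1), cqWeight α j *
          (mlRelax α (lam ^ (1 / α) * (((n - j : ℕ) : ℝ) * τ)) - 1)|
        ≤ c * τ * ((n : ℝ) * τ) ^ (-1 - (1 - β) * α) := by
  obtain ⟨C, hC0, hC⟩ := cq_consistency_unit_step hα0 hα1
  have hG : 0 < Gamma (1 - α) := Gamma_pos_of_pos (by linarith)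
  refine ⟨C * (1 + Gamma (1 - α)), by positivity, fun lam τ hlam hτ n hn => ?_⟩
  have hn0 : (0 : ℝ) < n := by exact_mod_cast hn
  set σ := lam ^ (1 / α) with hσ
  have hσ0 : 0 < σ := rpow_pos_of_pos hlam _
  have hσα : σ ^ α = lam := by
    rw [hσ, ← rpow_mul hlam.le, one_div_mul_cancel hα0.ne', rpow_one]
  set μ := σ * τ with hμ
  have hμ0 : 0 < μ := mul_pos hσ0 hτ
  have hμα : μ ^ α = lam * τ ^ α := by rw [hμ, mul_rpow hσ0.le hτ.le, hσα]
  obtain ⟨hi, hI⟩ := integral_sub_rpow_mul_mlKernel_mul hα0 hα1 hμ0 hn0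
  have key := hC (fun x => mlRelax α (μ * x)) (fun x => μ * mlKernel α (μ * x))
    (fun x => μ * (μ * mlKernelSlope α (μ * x))) (continuousOn_mlRelax_mul hα0 hα1 hμ0)
    (fun x hx => hasDerivAt_comp_mul (fun x hx => hasDerivAt_mlRelax hα0 hα1 hx) hμ0 hx)
    (fun x hx => by
      simpa using (hasDerivAt_comp_mul (fun x hx => hasDerivAt_mlKernel hα0 hα1 hx)
        hμ0 hx).const_mul μ)
    (fun x hx => mul_nonneg hμ0.le (mlKernel_nonneg hα0 hα1 (mul_pos hμ0 hx)))
    (fun x hx => mul_nonneg hμ0.le (mul_nonneg hμ0.le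
      (mlKernelSlope_nonneg hα0 hα1 (mul_pos hμ0 hx))))
    (fun x hx y hy hxy => by
      have := antitoneOn_mlKernelSlope hα0 hα1 (mul_pos hμ0 hx) (mul_pos hμ0 hy)
        (mul_le_mul_of_nonneg_left hxy hμ0.le)
      dsimp only
      gcongr) n hn hi
  simp only [mul_neg, intervalIntegral.integral_neg, hI, mul_zero, mlRelax_zero] at key
  have hD := one_sub_mlRelax_mul_le_rpow hα0 hα1 hβ0 hβ1 (mul_pos hμ0 hn0)
  have ht0 : 0 < (n : ℝ) * τ := by positivity
  have hτα : τ ^ (-α) * τ ^ α = 1 := by rw [← rpow_add hτ, neg_add_cancel, rpow_zero]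
  have hsum : ∑ j ∈ Finset.range (n + 1),
      cqWeight α j * (mlRelax α (σ * (((n - j : ℕ) : ℝ) * τ)) - 1)
      = ∑ j ∈ Finset.range (n + 1), cqWeight α j * (mlRelax α (μ * (n - j)) - 1) := by
    refine Finset.sum_congr rfl fun j hj => ?_
    rw [Nat.cast_sub (Nat.lt_succ_iff.1 (Finset.mem_range.1 hj)),
      show σ * (((n : ℝ) - j) * τ) = μ * (n - j) by rw [hμ]; ring]
  rw [hsum, show σ * (n * τ) = μ * n by rw [hμ]; ring]
  have heq : -lam * mlRelax α (μ * n) - τ ^ (-α) *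
        ∑ j ∈ Finset.range (n + 1), cqWeight α j * (mlRelax α (μ * (n - j)) - 1)
      = τ ^ (-α) * (-(1 / Gamma (1 - α) * (μ ^ α * Gamma (1 - α) * mlRelax α (μ * n)))
        - ∑ j ∈ Finset.range (n + 1), cqWeight α j * (mlRelax α (μ * (n - j)) - 1)) := by
    rw [show 1 / Gamma (1 - α) * (μ ^ α * Gamma (1 - α) * mlRelax α (μ * n))
      = μ ^ α * mlRelax α (μ * n) by field_simp, hμα]
    linear_combination lam * mlRelax α (μ * n) * hτα
  have hp1 : 0 < lam ^ (-β) := rpow_pos_of_pos hlam _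
  have hp2 : 0 < τ ^ (-α) := rpow_pos_of_pos hτ _
  have hp3 : ((μ * n) ^ α) ^ β = lam ^ β * ((n : ℝ) * τ) ^ (α * β) := by
    rw [show μ * n = σ * (n * τ) by rw [hμ]; ring, mul_rpow hσ0.le ht0.le, hσα,
      mul_rpow hlam.le (rpow_nonneg ht0.le _), ← rpow_mul ht0.le]
  have hp4 : τ ^ (-α) * (n : ℝ) ^ (-1 - α) = τ * ((n : ℝ) * τ) ^ (-1 - α) := by
    rw [mul_rpow hn0.le hτ.le, show -α = 1 + (-1 - α) by ring, rpow_add hτ, rpow_one]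
    ring_nf
  have hp5 : ((n : ℝ) * τ) ^ (-1 - (1 - β) * α)
      = ((n : ℝ) * τ) ^ (-1 - α) * ((n : ℝ) * τ) ^ (α * β) := by
    rw [← rpow_add ht0]; congr 1; ring
  have hp6 : lam ^ (-β) * lam ^ β = 1 := by rw [← rpow_add hlam, neg_add_cancel, rpow_zero]
  rw [heq, abs_mul, abs_of_pos hp2]
  calc _ ≤ lam ^ (-β) * (τ ^ (-α) * (C * (n : ℝ) ^ (-1 - α) *
        ((1 + Gamma (1 - α)) * ((μ * n) ^ α) ^ β))) := by
        gcongr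
        refine key.trans ?_
        gcongr
    _ = (lam ^ (-β) * lam ^ β) * (C * (1 + Gamma (1 - α))) * (τ ^ (-α) * (n : ℝ) ^ (-1 - α))
        * ((n : ℝ) * τ) ^ (α * β) := by rw [hp3]; ring
    _ = _ := by rw [hp4, hp5, hp6]; ring

end

theorem norm_le_of_forall_norm_inner_le {V ι : Type*} [NormedAddCommGroup V]
    [InnerProductSpace ℂ V] [Fintype ι] (b : OrthonormalBasis ι ℂ V)
    {x y : V} {c : ℝ} (hc : 0 ≤ c) (h : ∀ i, ‖⟪b i, x⟫‖ ≤ c * ‖⟪b i, y⟫‖) : ‖x‖ ≤ c * ‖y‖ := by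
  refine le_of_sq_le_sq ?_ (by positivity)
  rw [mul_pow, ← b.sum_sq_norm_inner_right x, ← b.sum_sq_norm_inner_right y, Finset.mul_sum]
  refine Finset.sum_le_sum fun i _ => ?_
  rw [← mul_pow]
  exact pow_le_pow_left₀ (norm_nonneg _) (h i) 2

section

variable {V : Type} [NormedAddCommGroup V] [InnerProductSpace ℂ V] [FiniteDimensional ℂ V]

theorem finite_spectrum_real (A : V →L[ℂ] V) : (spectrum ℝ A).Finite := by
  rw [← spectrum.preimage_algebraMap ℂ]
  refine Set.Finite.preimage (FaithfulSMul.algebraMap_injective ℝ ℂ).injOn ?_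
  have h : spectrum ℂ (Module.End.toContinuousLinearMap V (A : Module.End ℂ V))
      = spectrum ℂ (A : Module.End ℂ V) := AlgEquiv.spectrum_eq _ _
  exact h ▸ Module.End.finite_spectrum _

theorem cfc_apply_eigenvector {A : V →L[ℂ] V} (hA : IsSelfAdjoint A) (f : ℝ → ℝ) {lam : ℝ} {φ : V}
    (hφ : A φ = (lam : ℂ) • φ) : cfc f A φ = (f lam : ℂ) • φ := by
  have hcont : ∀ g : ℝ → ℝ, ContinuousOn g (spectrum ℝ A) :=
    fun g => (finite_spectrum_real A).continuousOn g
  have h1 : f = fun x => f lam + (f x - f lam) / (x - lam) * (x - lam) := by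
    ext x
    rcases eq_or_ne x lam with rfl | h
    · simp
    · rw [div_mul_cancel₀ _ (sub_ne_zero.2 h)]; ring
  rw [h1, cfc_add (a := A) (fun _ => f lam) _ (hcont _) (hcont _),
    cfc_mul (a := A) (fun x => (f x - f lam) / (x - lam)) (fun x => x - lam) (hcont _) (hcont _),
    cfc_sub (a := A) (fun x => x) (fun _ => lam) (hcont _) (hcont _), cfc_const _ A hA,
    cfc_const _ A hA, cfc_id' ℝ A hA]
  have h2 : (A - algebraMap ℝ (V →L[ℂ] V) lam) φ = 0 := by
    simp [Algebra.algebraMap_eq_smul_one, hφ]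
  rw [add_apply, mul_apply_eq_comp, h2]
  simp [Algebra.algebraMap_eq_smul_one]

theorem inner_cfc_eigenvector {A : V →L[ℂ] V} (hA : IsSelfAdjoint A) (f : ℝ → ℝ) {lam : ℝ} {φ : V}
    (hφ : A φ = (lam : ℂ) • φ) (x : V) : ⟪φ, cfc f A x⟫ = (f lam : ℂ) * ⟪φ, x⟫ := by
  have h : IsSelfAdjoint (cfc f A) := cfc_predicate f A
  have h1 := h.isSymmetric φ x
  simp only [ContinuousLinearMap.coe_coe] at h1
  rw [← h1, cfc_apply_eigenvector hA f hφ, inner_smul_left, Complex.conj_ofReal]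

end

section

variable {α : ℝ} {V : Type} [NormedAddCommGroup V] [InnerProductSpace ℂ V] [CompleteSpace V]
  {u u' : ℝ → V} {t : ℝ}

theorem integrableOn_smul_deriv (hd : ∀ t : ℝ, 0 < t → HasDerivAt u (u' t) t)
    (hi : IntegrableOn (fun s => (t - s) ^ (-α) * ‖u' s‖) (Ioo 0 t)) :
    IntegrableOn (fun s => ((t - s) ^ (-α) : ℝ) • u' s) (Ioo 0 t) := by
  have h1 : AEStronglyMeasurable u' (volume.restrict (Ioo 0 t)) := by
    refine (stronglyMeasurable_deriv u).aestronglyMeasurable.congr ?_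
    filter_upwards [ae_restrict_mem measurableSet_Ioo] with s hs using (hd s hs.1).deriv
  have h2 : AEStronglyMeasurable (fun s : ℝ => ((t - s) ^ (-α) : ℝ) • u' s)
      (volume.restrict (Ioo 0 t)) :=
    (by fun_prop : Measurable fun s : ℝ => ((t - s) ^ (-α) : ℝ)).aestronglyMeasurable.smul h1
  refine (integrable_norm_iff h2).1 (hi.congr ?_)
  filter_upwards [ae_restrict_mem measurableSet_Ioo] with s hs
  rw [norm_smul, norm_of_nonneg (rpow_nonneg (by linarith [hs.2]) _)]

theorem clm_apply_eq_mlRelax (hα0 : 0 < α) (hα1 : α < 1) {A : V →L[ℂ] V} {lam : ℝ} (hlam : 0 < lam)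
    (L : V →L[ℝ] ℝ) (hL : ∀ x, L (A x) = lam * L x) (hc : ContinuousOn u (Ici 0))
    (hd : ∀ t : ℝ, 0 < t → HasDerivAt u (u' t) t)
    (hi : ∀ t : ℝ, 0 < t → IntegrableOn (fun s => (t - s) ^ (-α) * ‖u' s‖) (Ioo 0 t))
    (heq : ∀ t : ℝ, 0 < t → caputo α u' t + A (u t) = 0) (ht : 0 ≤ t) :
    L (u t) = mlRelax α (lam ^ (1 / α) * t) * L (u 0) := by
  have hG : 0 < Gamma (1 - α) := Gamma_pos_of_pos (by linarith)
  set σ := lam ^ (1 / α) with hσ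
  have hσ0 : 0 < σ := rpow_pos_of_pos hlam _
  have hσα : σ ^ α = lam := by
    rw [hσ, ← rpow_mul hlam.le, one_div_mul_cancel hα0.ne', rpow_one]
  have hLi : ∀ t : ℝ, 0 < t → IntervalIntegrable (fun s => (t - s) ^ (-α) * L (u' s)) volume 0 t :=
    fun t ht => by
      rw [intervalIntegrable_iff_integrableOn_Ioo_of_le ht.le]
      have h := L.integrable_comp (integrableOn_smul_deriv hd (hi t ht))
      simp only [map_smul, smul_eq_mul] at h
      exact h
  have hLI : ∀ t : ℝ, 0 < t →
      ∫ s in (0 : ℝ)..t, (t - s) ^ (-α) * L (u' s) = -(Gamma (1 - α) * lam) * L (u t) :=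
    fun t ht => by
      have h1 := congrArg L (eq_neg_of_add_eq_zero_left (heq t ht))
      rw [map_neg, hL, caputo, map_smul,
        ← L.integral_comp_comm (integrableOn_smul_deriv hd (hi t ht))] at h1
      simp only [map_smul, smul_eq_mul] at h1
      rw [intervalIntegral.integral_of_le ht.le, integral_Ioc_eq_integral_Ioo]
      field_simp at h1
      linarith
  have h0 := eq_zero_of_fracODE hα0 hα1 (f := fun t => L (u t) - mlRelax α (σ * t) * L (u 0))
    (f' := fun t => L (u' t) + (σ * mlKernel α (σ * t)) * L (u 0)) (mul_pos hG hlam)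
    ((L.continuous.comp_continuousOn hc).sub
      ((continuousOn_mlRelax_mul hα0 hα1 hσ0).mul continuousOn_const))
    (by simp [mlRelax_zero])
    (fun t ht => by
      have h1 := L.hasFDerivAt.comp_hasDerivAt t (hd t ht)
      have h2 := (hasDerivAt_comp_mul (fun x hx => hasDerivAt_mlRelax hα0 hα1 hx) hσ0 ht).mul_const
        (L (u 0))
      refine (h1.sub h2).congr_deriv ?_
      ring)
    (fun t ht => by
      have h1 := (integral_sub_rpow_mul_mlKernel_mul hα0 hα1 hσ0 ht).1.mul_const (L (u 0))
      refine ((hLi t ht).add h1).congr fun s _ => ?_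
      ring)
    (fun t ht => by
      obtain ⟨h1, h2⟩ := integral_sub_rpow_mul_mlKernel_mul hα0 hα1 hσ0 ht
      simp only [mul_add]
      have h3 := h1.mul_const (L (u 0))
      simp only [mul_assoc] at h2 h3 ⊢
      simp only [← mul_assoc] at h2 h3 ⊢
      rw [intervalIntegral.integral_add (hLi t ht) h3, hLI t ht,
        intervalIntegral.integral_mul_const]
      rw [h2, hσα]
      ring) ht
  linarith

theorem inner_eq_mlRelax (hα0 : 0 < α) (hα1 : α < 1) {A : V →L[ℂ] V} (hA : IsSelfAdjoint A)
    {lam : ℝ} (hlam : 0 < lam) {φ : V} (hφ : A φ = (lam : ℂ) • φ) (hc : ContinuousOn u (Ici 0))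
    (hd : ∀ t : ℝ, 0 < t → HasDerivAt u (u' t) t)
    (hi : ∀ t : ℝ, 0 < t → IntegrableOn (fun s => (t - s) ^ (-α) * ‖u' s‖) (Ioo 0 t))
    (heq : ∀ t : ℝ, 0 < t → caputo α u' t + A (u t) = 0) (ht : 0 ≤ t) :
    ⟪φ, u t⟫ = (mlRelax α (lam ^ (1 / α) * t) : ℂ) * ⟪φ, u 0⟫ := by
  have hin : ∀ x, ⟪φ, A x⟫ = (lam : ℂ) * ⟪φ, x⟫ := fun x => by
    have h1 := hA.isSymmetric φ x
    simp only [ContinuousLinearMap.coe_coe] at h1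
    rw [← h1, hφ, inner_smul_left, Complex.conj_ofReal]
  apply Complex.ext
  · have := clm_apply_eq_mlRelax hα0 hα1 hlam
      (Complex.reCLM.comp ((innerSL ℂ φ).restrictScalars ℝ)) (fun x => by simp [hin])
      hc hd hi heq ht
    simpa using this
  · have := clm_apply_eq_mlRelax hα0 hα1 hlam
      (Complex.imCLM.comp ((innerSL ℂ φ).restrictScalars ℝ)) (fun x => by simp [hin])
      hc hd hi heq ht
    simpa using this

end

end BackwardEulerCQ

/-- Consistency error of the backward Euler CQ for nonsmooth initial data:
`‖A^{-β} (∂_t^α u(t_n) - ∂̄_τ^α y(t_n))‖ ≤ c τ t_n^{-1-(1-β)α} ‖v‖` where `y = u - v`. -/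
theorem cq_consistency_nonsmooth_data (α β : ℝ) (hα0 : 0 < α) (hα1 : α < 1)
    (hβ0 : 0 ≤ β) (hβ1 : β ≤ 1) :
    ∃ c : ℝ, 0 < c ∧
      ∀ (V : Type) (_ : NormedAddCommGroup V) (_ : InnerProductSpace ℂ V)
        (_ : FiniteDimensional ℂ V) (_ : Nontrivial V)
        (A : V →L[ℂ] V), IsSelfAdjoint A →
        (∀ x : V, x ≠ 0 → 0 < (⟪A x, x⟫).re) →
        ∀ (v : V) (u u' : ℝ → V),
        ContinuousOn u (Set.Ici 0) → u 0 = v →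
        (∀ t : ℝ, 0 < t → HasDerivAt u (u' t) t) →
        (∀ t : ℝ, 0 < t →
          MeasureTheory.IntegrableOn (fun s => (t - s) ^ (-α) * ‖u' s‖) (Set.Ioo 0 t)) →
        (∀ t : ℝ, 0 < t → caputo α u' t + A (u t) = 0) →
        ∀ τ : ℝ, 0 < τ → ∀ n : ℕ, 1 ≤ n →
          ‖opRPow A (-β) (caputo α u' ((n : ℝ) * τ)
              - τ ^ (-α) • ∑ j ∈ Finset.range (n + 1),
                  cqWeight α j • (u (((n - j : ℕ) : ℝ) * τ) - v))‖
            ≤ c * τ * ((n : ℝ) * τ) ^ (-1 - (1 - β) * α) * ‖v‖ := by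
  obtain ⟨c, hc0, hc⟩ := BackwardEulerCQ.cq_consistency_mlRelax hα0 hα1 hβ0 hβ1
  refine ⟨c, hc0, fun V _ _ _ _ A hA hpos v u u' hcont hu0 hd hi heq τ hτ n hn => ?_⟩
  have hn0 : (0 : ℝ) < n := by exact_mod_cast hn
  have ht : 0 < (n : ℝ) * τ := mul_pos hn0 hτ
  have hcomplete : CompleteSpace V := FiniteDimensional.complete ℂ V
  have hsymm := hA.isSymmetric
  refine BackwardEulerCQ.norm_le_of_forall_norm_inner_le (hsymm.eigenvectorBasis rfl)
    (by positivity) fun i => ?_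
  set φ := hsymm.eigenvectorBasis rfl i with hφ_def
  set lam := hsymm.eigenvalues rfl i with hlam_def
  have hφ : A φ = (lam : ℂ) • φ := hsymm.apply_eigenvectorBasis rfl i
  have hφ1 : ‖φ‖ = 1 := (hsymm.eigenvectorBasis rfl).norm_eq_one i
  have hlam : 0 < lam := by
    have h := hpos φ (norm_ne_zero_iff.1 (by simp [hφ1]))
    rw [hφ, inner_smul_left, inner_self_eq_norm_sq_to_K, hφ1] at h
    simpa using h
  have hmode : ∀ t : ℝ, 0 ≤ t →
      ⟪φ, u t⟫ = (MittagLeffler.mlRelax α (lam ^ (1 / α) * t) : ℂ) * ⟪φ, v⟫ := fun t ht => by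
    rw [BackwardEulerCQ.inner_eq_mlRelax hα0 hα1 hA hlam hφ hcont hd hi heq ht, hu0]
  have hAu : ⟪φ, A (u (n * τ))⟫ = (lam : ℂ) * ⟪φ, u (n * τ)⟫ := by
    have h := hsymm φ (u (n * τ))
    simp only [ContinuousLinearMap.coe_coe] at h
    rw [← h, hφ, inner_smul_left, Complex.conj_ofReal]
  rw [opRPow, BackwardEulerCQ.inner_cfc_eigenvector hA _ hφ,
    eq_neg_of_add_eq_zero_left (heq _ ht), inner_sub_right, inner_neg_right, hAu, hmode _ ht.le,
    inner_smul_right_eq_smul, inner_sum]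
  have hsum : ∑ j ∈ Finset.range (n + 1), ⟪φ, cqWeight α j • (u (((n - j : ℕ) : ℝ) * τ) - v)⟫
      = ((∑ j ∈ Finset.range (n + 1), cqWeight α j * (MittagLeffler.mlRelax α
          (lam ^ (1 / α) * (((n - j : ℕ) : ℝ) * τ)) - 1) : ℝ) : ℂ) * ⟪φ, v⟫ := by
    push_cast
    rw [Finset.sum_mul]
    refine Finset.sum_congr rfl fun j _ => ?_
    rw [inner_smul_right_eq_smul, inner_sub_right, hmode _ (by positivity), Complex.real_smul]
    ring
  rw [hsum, Complex.real_smul]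
  have hfac : ((lam ^ (-β) : ℝ) : ℂ) *
        (-((lam : ℂ) * ((MittagLeffler.mlRelax α (lam ^ (1 / α) * (n * τ)) : ℂ) * ⟪φ, v⟫))
        - ((τ ^ (-α) : ℝ) : ℂ) * (((∑ j ∈ Finset.range (n + 1), cqWeight α j *
          (MittagLeffler.mlRelax α (lam ^ (1 / α) * (((n - j : ℕ) : ℝ) * τ)) - 1) : ℝ) : ℂ)
          * ⟪φ, v⟫))
      = ((lam ^ (-β) * (-lam * MittagLeffler.mlRelax α (lam ^ (1 / α) * (n * τ)) - τ ^ (-α) *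
        ∑ j ∈ Finset.range (n + 1), cqWeight α j *
          (MittagLeffler.mlRelax α (lam ^ (1 / α) * (((n - j : ℕ) : ℝ) * τ)) - 1)) : ℝ) : ℂ)
        * ⟪φ, v⟫ := by
    push_cast
    ring
  rw [hfac, norm_mul, Complex.norm_real, norm_mul, Real.norm_eq_abs, Real.norm_eq_abs,
    abs_of_pos (Real.rpow_pos_of_pos hlam _)]
  exact mul_le_mul_of_nonneg_right (hc lam τ hlam hτ n hn) (norm_nonneg _)
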